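/- arXiv:1412.6773 — 12 statements merged into one kernel-verified Lean document; each statement's English description precedes it below -/
import Mathlib

section
/- Suppose −y < r/(4c). Then the value of the differential game is infinite at every initial condition: for every x ∈ [0,D], V(x) = +∞; that is, for every admissible strategy α ∈ A_x, the supremum over path controls p and horizons T ≥ 0 of the cost c(x,T,p,α[p]) equals +∞. -/
open MeasureTheory Set Filter

noncomputable section

/-- A path control: a pair of measurable, locally square-integrable functions,
representing the densities of the absolutely continuous paths chosen by the maximizer. -/
structure PathControl where
  p1 : ℝ → ℝ
  p2 : ℝ → ℝ
  meas1 : Measurable p1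
  meas2 : Measurable p2
  sq1 : ∀ T : ℝ, IntegrableOn (fun t => p1 t ^ 2) (Ioc 0 T)
  sq2 : ∀ T : ℝ, IntegrableOn (fun t => p2 t ^ 2) (Ioc 0 T)

/-- The rate-function cost `I(T,p) = ∫₀ᵀ (c₁ p¹² + c₂ p²²)`. -/
def rateCost (c1 c2 : ℝ) (p : PathControl) (T : ℝ) : ℝ :=
  ∫ t in Ioc (0:ℝ) T, (c1 * p.p1 t ^ 2 + c2 * p.p2 t ^ 2)

/-- An element of `E`: a nondecreasing, right-continuous, nonnegative function on `[0,∞)`. -/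
structure IncE where
  f : ℝ → ℝ
  nonneg : ∀ t, 0 ≤ f t
  mono : MonotoneOn f (Ici (0:ℝ))
  rightCont : ∀ t ∈ Ici (0:ℝ), ContinuousWithinAt f (Ici t) t

/-- `∫₀ᵗ (p¹ − p²)`. -/
def netInput (p : PathControl) (t : ℝ) : ℝ :=
  ∫ s in Ioc (0:ℝ) t, (p.p1 s - p.p2 s)

/-- Two path controls agree a.e. on `[0,t]`. -/
def AgreeUpTo (p q : PathControl) (t : ℝ) : Prop :=
  (∀ᵐ s ∂volume, s ∈ Ioc (0:ℝ) t → p.p1 s = q.p1 s) ∧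
  (∀ᵐ s ∂volume, s ∈ Ioc (0:ℝ) t → p.p2 s = q.p2 s)
/-- Dynamics of the original game: `φ(t) = x + y t + ∫₀ᵗ(p¹−p²) + ζ(t) − ρ(t)`. -/
def dyn (x y : ℝ) (p : PathControl) (ζ ρ : IncE) (t : ℝ) : ℝ :=
  x + y * t + netInput p t + ζ.f t - ρ.f t

/-- A strategy for the minimizer in the original game: a causal map from
path controls to pairs `(ζ,ρ) ∈ E²`. -/
structure Strategy where
  act : PathControl → IncE × IncE
  causal : ∀ p q : PathControl, ∀ t : ℝ, 0 ≤ t → AgreeUpTo p q t →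
    ∀ s ∈ Icc (0:ℝ) t, (act p).1.f s = (act q).1.f s ∧ (act p).2.f s = (act q).2.f s

/-- A strategy is admissible at `x` if the dynamics always stays in `[0,D]`. -/
def Admissible (D x y : ℝ) (α : Strategy) : Prop :=
  ∀ p : PathControl, ∀ t : ℝ, 0 ≤ t →
    dyn x y p (α.act p).1 (α.act p).2 t ∈ Icc (0:ℝ) D

/-- The cost of the original game up to horizon `T`. -/
def cost (c1 c2 r : ℝ) (h : ℝ → ℝ) (x y : ℝ)
    (p : PathControl) (ζ ρ : IncE) (T : ℝ) : ℝ :=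
  (∫ t in Ioc (0:ℝ) T, h (dyn x y p ζ ρ t)) + r * ρ.f T - rateCost c1 c2 p T

/-- The value `V(x)` of the original game (as an extended real). -/
def value (c1 c2 r D : ℝ) (h : ℝ → ℝ) (y x : ℝ) : EReal :=
  ⨅ α : {α : Strategy // Admissible D x y α},
    ⨆ p : PathControl, ⨆ T : {T : ℝ // 0 ≤ T},
      ((cost c1 c2 r h x y p (α.1.act p).1 (α.1.act p).2 T : ℝ) : EReal)

/-- The path control with constant densities `a` and `b`. -/
def PathControl.const (a b : ℝ) : PathControl where
  p1 := fun _ => a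
  p2 := fun _ => b
  meas1 := measurable_const
  meas2 := measurable_const
  sq1 := fun _ => integrableOn_const (by simp)
  sq2 := fun _ => integrableOn_const (by simp)

theorem netInput_const (a b : ℝ) {T : ℝ} (hT : 0 ≤ T) :
    netInput (PathControl.const a b) T = T * (a - b) := by
  simp [netInput, PathControl.const, hT]

theorem rateCost_const (c1 c2 a b : ℝ) {T : ℝ} (hT : 0 ≤ T) :
    rateCost c1 c2 (PathControl.const a b) T = T * (c1 * a ^ 2 + c2 * b ^ 2) := by
  simp [rateCost, PathControl.const, hT]

/-- Since the dynamics cannot exceed `D`, the rejection cost is at least the net inflow beyond `D`,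
which bounds the cost of a constant path control from below by an affine function of the horizon. -/
theorem le_cost_const {c1 c2 y r D : ℝ} (hr : 0 < r) {h : ℝ → ℝ}
    (hnn : ∀ u ∈ Icc (0:ℝ) D, 0 ≤ h u) {x : ℝ} {α : Strategy} (hα : Admissible D x y α)
    (a b : ℝ) {T : ℝ} (hT : 0 ≤ T) :
    T * (r * (y + (a - b)) - (c1 * a ^ 2 + c2 * b ^ 2)) + r * (x - D) ≤
      cost c1 c2 r h x y (PathControl.const a b) (α.act (PathControl.const a b)).1
        (α.act (PathControl.const a b)).2 T := by
  set p := PathControl.const a b with hp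
  have hint : 0 ≤ ∫ t in Ioc (0:ℝ) T, h (dyn x y p (α.act p).1 (α.act p).2 t) :=
    setIntegral_nonneg measurableSet_Ioc fun t ht => hnn _ (hα p t ht.1.le)
  have hdyn := (hα p T hT).2
  have hζ := (α.act p).1.nonneg T
  rw [dyn, hp, netInput_const a b hT, ← hp] at hdyn
  rw [cost, hp, rateCost_const c1 c2 a b hT, ← hp]
  have hρ : x + y * T + T * (a - b) - D ≤ (α.act p).2.f T := by linarith
  nlinarith [mul_le_mul_of_nonneg_left hρ hr.le]

/-- if `−y < r/(4c)` then `V(x) = +∞` for every `x ∈ [0,D]`: for every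
admissible strategy `α`, the supremum over path controls and horizons of the cost is `+∞`. -/
theorem stmt0 (c1 c2 y r D : ℝ) (hc1 : 0 < c1) (hc2 : 0 < c2) (hr : 0 < r) (hD : 0 < D)
    (h : ℝ → ℝ) (hcont : ContinuousOn h (Icc 0 D)) (hmono : StrictMonoOn h (Icc 0 D))
    (hnn : ∀ u ∈ Icc (0:ℝ) D, 0 ≤ h u) (h0 : h 0 = 0)
    (c : ℝ) (hc : c = (c1⁻¹ + c2⁻¹)⁻¹)
    (hy : -y < r / (4 * c))
    (x : ℝ) (hx : x ∈ Icc (0:ℝ) D) :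
    ∀ α : Strategy, Admissible D x y α →
      (⨆ p : PathControl, ⨆ T : {T : ℝ // 0 ≤ T},
        ((cost c1 c2 r h x y p (α.act p).1 (α.act p).2 T.1 : ℝ) : EReal)) = ⊤ := by
  intro α hα
  set a : ℝ := r / (2 * c1) with ha
  set b : ℝ := -(r / (2 * c2)) with hb
  have hrate : r * (y + (a - b)) - (c1 * a ^ 2 + c2 * b ^ 2) = r * (y + r / (4 * c)) := by
    rw [ha, hb, hc]
    field_simp
    ring
  have hgrowth : 0 < r * (y + r / (4 * c)) := mul_pos hr (by linarith)
  rw [EReal.eq_top_iff_forall_lt]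
  intro M
  obtain ⟨T, hT, hTM⟩ :
      ∃ T : ℝ, 0 ≤ T ∧ M < T * (r * (y + r / (4 * c))) + r * (x - D) := by
    refine ⟨max 0 ((M - r * (x - D) + 1) / (r * (y + r / (4 * c)))), le_max_left _ _, ?_⟩
    have := (div_le_iff₀ hgrowth).1
      (le_max_right 0 ((M - r * (x - D) + 1) / (r * (y + r / (4 * c)))))
    linarith
  have hcost := le_cost_const (c1 := c1) (c2 := c2) hr hnn hα a b hT
  rw [hrate] at hcost
  exact lt_of_lt_of_le (EReal.coe_lt_coe_iff.2 (hTM.trans_le hcost))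
    (le_iSup₂_of_le (PathControl.const a b) ⟨T, hT⟩ le_rfl)
end
end

section
/- Suppose −y ≥ r/(4c). Then for every x ∈ [0,D] one has 0 ≤ V(x) ≤ r·x; in particular V(0) = 0. Moreover, V is nondecreasing on [0,D], and V is continuous on [0,D]. -/
open MeasureTheory Set Filter

noncomputable section

lemma integrableOn_of_sq {f : ℝ → ℝ} (hf : Measurable f) {T : ℝ}
    (h2 : IntegrableOn (fun t => f t ^ 2) (Ioc 0 T)) : IntegrableOn f (Ioc 0 T) := by
  have h1 : IntegrableOn (fun _ : ℝ => (1 : ℝ)) (Ioc 0 T) := by simp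
  refine Integrable.mono' (h1.add h2) hf.aestronglyMeasurable (ae_of_all _ fun t => ?_)
  simp only [Pi.add_apply, Real.norm_eq_abs]
  exact abs_le.2 ⟨by nlinarith [sq_nonneg (f t + 1)], by nlinarith [sq_nonneg (f t - 1)]⟩

lemma PathControl.integrableOn_sub (p : PathControl) (T : ℝ) :
    IntegrableOn (fun t => p.p1 t - p.p2 t) (Ioc 0 T) :=
  (integrableOn_of_sq p.meas1 (p.sq1 T)).sub (integrableOn_of_sq p.meas2 (p.sq2 T))

lemma setIntegral_congr_of_agree {p q : PathControl} {t s : ℝ} (hpq : AgreeUpTo p q t)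
    (hs : s ≤ t) (F : ℝ → ℝ → ℝ) :
    ∫ u in Ioc (0:ℝ) s, F (p.p1 u) (p.p2 u) = ∫ u in Ioc (0:ℝ) s, F (q.p1 u) (q.p2 u) := by
  refine setIntegral_congr_ae measurableSet_Ioc ?_
  filter_upwards [hpq.1, hpq.2] with u h1 h2 hu
  rw [h1 ⟨hu.1, hu.2.trans hs⟩, h2 ⟨hu.1, hu.2.trans hs⟩]

lemma continuousOn_setIntegral {f : ℝ → ℝ} (hf : ∀ T, IntegrableOn f (Ioc 0 T)) (T : ℝ) :
    ContinuousOn (fun t => ∫ s in Ioc (0:ℝ) t, f s) (Icc 0 T) :=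
  intervalIntegral.continuousOn_primitive ((integrableOn_Icc_iff_integrableOn_Ioc (by simp)).2 (hf T))

lemma continuousWithinAt_setIntegral {f : ℝ → ℝ} (hf : ∀ T, IntegrableOn f (Ioc 0 T)) {t : ℝ}
    (ht : 0 ≤ t) : ContinuousWithinAt (fun t => ∫ s in Ioc (0:ℝ) t, f s) (Ici t) t := by
  have hlt : t < t + 1 := by linarith
  rw [← continuousWithinAt_Icc_iff_Ici hlt]
  exact (continuousOn_setIntegral hf (t + 1) t ⟨ht, hlt.le⟩).mono (Icc_subset_Icc_left ht)

/-- The primitive of a nonnegative locally integrable function. -/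
def IncE.primitive (f : ℝ → ℝ) (hf : ∀ T, IntegrableOn f (Ioc 0 T)) (h0 : ∀ t, 0 ≤ f t) :
    IncE where
  f t := ∫ s in Ioc (0:ℝ) t, f s
  nonneg _ := setIntegral_nonneg measurableSet_Ioc fun s _ => h0 s
  mono _ _ _ _ hst := setIntegral_mono_set (hf _) (ae_of_all _ h0)
    (Ioc_subset_Ioc_right hst).eventuallyLE
  rightCont _ ht := continuousWithinAt_setIntegral hf ht

/-- Addition of a nonnegative jump at time `0`. -/
def IncE.addConst (ρ : IncE) (δ : ℝ) (hδ : 0 ≤ δ) : IncE where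
  f t := ρ.f t + δ
  nonneg t := add_nonneg (ρ.nonneg t) hδ
  mono _ hs _ ht hst := add_le_add_left (ρ.mono hs ht hst) δ
  rightCont t ht := (ρ.rightCont t ht).add continuousWithinAt_const

/-- Sum of two elements of `E`. -/
def IncE.add (ζ ξ : IncE) : IncE where
  f t := ζ.f t + ξ.f t
  nonneg t := add_nonneg (ζ.nonneg t) (ξ.nonneg t)
  mono _ hs _ ht hst := add_le_add (ζ.mono hs ht hst) (ξ.mono hs ht hst)
  rightCont t ht := (ζ.rightCont t ht).add (ξ.rightCont t ht)

lemma le_sSup_image_Icc {g : ℝ → ℝ} {B : ℝ} (hB : ∀ t, 0 ≤ t → g t ≤ B) {s t : ℝ} (hs : 0 ≤ s)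
    (hst : s ≤ t) : g s ≤ sSup (g '' Icc 0 t) :=
  le_csSup ⟨B, by rintro _ ⟨u, hu, rfl⟩; exact hB u hu.1⟩ ⟨s, ⟨hs, hst⟩, rfl⟩

lemma sSup_image_Icc_le {g : ℝ → ℝ} {B t : ℝ} (ht : 0 ≤ t)
    (hB : ∀ s, 0 ≤ s → s ≤ t → g s ≤ B) : sSup (g '' Icc 0 t) ≤ B :=
  csSup_le ⟨g 0, 0, ⟨le_rfl, ht⟩, rfl⟩ (by rintro _ ⟨u, hu, rfl⟩; exact hB u hu.1 hu.2)

/-- The running supremum of a bounded nonnegative right-continuous function. -/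
def IncE.runningSup (g : ℝ → ℝ) (B : ℝ) (h0 : ∀ t, 0 ≤ g t) (hB : ∀ t, 0 ≤ t → g t ≤ B)
    (hg : ∀ t, 0 ≤ t → ContinuousWithinAt g (Ici t) t) : IncE where
  f t := sSup (g '' Icc 0 t)
  nonneg t := Real.sSup_nonneg (by rintro _ ⟨u, -, rfl⟩; exact h0 u)
  mono _ hs _ _ hst :=
    sSup_image_Icc_le hs fun _ hu hus => le_sSup_image_Icc hB hu (hus.trans hst)
  rightCont t ht := by
    refine tendsto_order.2 ⟨fun a ha => ?_, fun a ha => ?_⟩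
    · filter_upwards [self_mem_nhdsWithin] with s hs
      exact ha.trans_le (sSup_image_Icc_le ht fun _ hu hut =>
        le_sSup_image_Icc hB hu (hut.trans hs))
    · obtain ⟨b, hb, hba⟩ := exists_between ha
      have hgt : g t < b := (le_sSup_image_Icc hB ht le_rfl).trans_lt hb
      have hev := (tendsto_order.1 (hg t ht)).2 b hgt
      obtain ⟨v, hv, hsub⟩ := mem_nhdsGE_iff_exists_Ico_subset.1 hev
      filter_upwards [Ico_mem_nhdsGE hv] with s hs
      refine (sSup_image_Icc_le (ht.trans hs.1) fun u hu hus => ?_).trans_lt hba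
      rcases le_total u t with hut | hut
      · exact (le_sSup_image_Icc hB hu hut).trans hb.le
      · exact le_of_lt (hsub ⟨hut, hus.trans_lt hs.2⟩)

lemma continuousWithinAt_dyn (x y : ℝ) (p : PathControl) (ζ ρ : IncE) {t : ℝ} (ht : 0 ≤ t) :
    ContinuousWithinAt (dyn x y p ζ ρ) (Ici t) t := by
  have h1 : ContinuousWithinAt (fun t => x + y * t) (Ici t) t := by fun_prop
  exact ((h1.add (continuousWithinAt_setIntegral p.integrableOn_sub ht)).add
    (ζ.rightCont t ht)).sub (ρ.rightCont t ht)

lemma IncE.aemeasurable (ζ : IncE) (T : ℝ) : AEMeasurable ζ.f (volume.restrict (Ioc 0 T)) :=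
  aemeasurable_restrict_of_monotoneOn measurableSet_Ioc
    (ζ.mono.mono fun _ ht => ht.1.le)

lemma aemeasurable_dyn (x y : ℝ) (p : PathControl) (ζ ρ : IncE) (T : ℝ) :
    AEMeasurable (dyn x y p ζ ρ) (volume.restrict (Ioc 0 T)) := by
  have h1 : AEMeasurable (fun t : ℝ => x + y * t) (volume.restrict (Ioc 0 T)) := by fun_prop
  have h2 : AEMeasurable (netInput p) (volume.restrict (Ioc 0 T)) :=
    ((continuousOn_setIntegral p.integrableOn_sub T).mono Ioc_subset_Icc_self).aemeasurable
      measurableSet_Ioc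
  exact ((h1.add h2).add (ζ.aemeasurable T)).sub (ρ.aemeasurable T)

lemma integrableOn_comp_dyn {D : ℝ} {h : ℝ → ℝ} (hcont : ContinuousOn h (Icc 0 D))
    (hD : 0 ≤ D) {x y : ℝ} {p : PathControl} {ζ ρ : IncE}
    (hdyn : ∀ t, 0 ≤ t → dyn x y p ζ ρ t ∈ Icc (0:ℝ) D) (T : ℝ) :
    IntegrableOn (fun t => h (dyn x y p ζ ρ t)) (Ioc 0 T) := by
  have hext : Continuous (IccExtend hD ((Icc 0 D).domRestrict h)) :=
    (continuousOn_iff_continuous_domRestrict.1 hcont).Icc_extend'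
  have heq : EqOn (fun t => IccExtend hD ((Icc 0 D).domRestrict h) (dyn x y p ζ ρ t))
      (fun t => h (dyn x y p ζ ρ t)) (Ioc 0 T) := fun t ht =>
    IccExtend_of_mem hD ((Icc 0 D).domRestrict h) (hdyn t ht.1.le)
  obtain ⟨C, hC⟩ := isCompact_Icc.exists_bound_of_continuousOn hcont
  have hmeas : AEStronglyMeasurable (fun t => h (dyn x y p ζ ρ t)) (volume.restrict (Ioc 0 T)) :=
    ((hext.measurable.comp_aemeasurable (aemeasurable_dyn x y p ζ ρ T)).congr
      (ae_restrict_of_forall_mem measurableSet_Ioc heq)).aestronglyMeasurable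
  refine Integrable.mono' (integrable_const C) hmeas ?_
  exact ae_restrict_of_forall_mem measurableSet_Ioc fun t ht => hC _ (hdyn t ht.1.le)

lemma value_nonneg (c1 c2 r D : ℝ) (hr : 0 < r) (h : ℝ → ℝ) (y x : ℝ) :
    (0 : EReal) ≤ value c1 c2 r D h y x := by
  refine le_iInf fun α => ?_
  let p : PathControl := ⟨0, 0, measurable_const, measurable_const, by simp, by simp⟩
  refine le_trans ?_ (le_iSup_of_le p (le_iSup_of_le ⟨0, le_rfl⟩ le_rfl))
  have : 0 ≤ cost c1 c2 r h x y p (α.1.act p).1 (α.1.act p).2 0 := by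
    simpa [cost, rateCost] using mul_nonneg hr.le ((α.1.act p).2.nonneg 0)
  exact_mod_cast this

lemma value_le_of_strategy {c1 c2 r D : ℝ} {h : ℝ → ℝ} {y x : ℝ} {α : Strategy}
    (hα : Admissible D x y α) {K : EReal}
    (hK : ∀ p T, 0 ≤ T → ((cost c1 c2 r h x y p (α.act p).1 (α.act p).2 T : ℝ) : EReal) ≤ K) :
    value c1 c2 r D h y x ≤ K :=
  iInf_le_of_le ⟨α, hα⟩ (iSup_le fun p => iSup_le fun T => hK p T T.2)

lemma value_le_add_of_forall_strategy {c1 c2 r D : ℝ} {h : ℝ → ℝ} {y x₁ x₂ k : ℝ}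
    (H : ∀ α, Admissible D x₁ y α → ∃ β, Admissible D x₂ y β ∧ ∀ p T, 0 ≤ T →
      cost c1 c2 r h x₂ y p (β.act p).1 (β.act p).2 T ≤
        cost c1 c2 r h x₁ y p (α.act p).1 (α.act p).2 T + k) :
    value c1 c2 r D h y x₂ ≤ value c1 c2 r D h y x₁ + k := by
  refine EReal.sub_le_iff_le_add (by simp) (by simp) |>.1 (le_iInf fun α => ?_)
  refine EReal.sub_le_iff_le_add (by simp) (by simp) |>.2 ?_
  obtain ⟨β, hβ, hcost⟩ := H α.1 α.2
  refine value_le_of_strategy hβ fun p T hT => ?_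
  calc ((cost c1 c2 r h x₂ y p (β.act p).1 (β.act p).2 T : ℝ) : EReal)
      ≤ ((cost c1 c2 r h x₁ y p (α.1.act p).1 (α.1.act p).2 T + k : ℝ) : EReal) :=
        EReal.coe_le_coe_iff.2 (hcost p T hT)
    _ = ((cost c1 c2 r h x₁ y p (α.1.act p).1 (α.1.act p).2 T : ℝ) : EReal) + (k : EReal) :=
        EReal.coe_add _ _
    _ ≤ _ := add_le_add_left (le_iSup_of_le p (le_iSup (fun T : {T : ℝ // 0 ≤ T} =>
        ((cost c1 c2 r h x₁ y p (α.1.act p).1 (α.1.act p).2 T : ℝ) : EReal)) ⟨T, hT⟩)) _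

/-- Rejecting the excess `x₂ - x₁` at time `0` shows the Lipschitz bound. -/
lemma value_le_value_add (c1 c2 r D : ℝ) (h : ℝ → ℝ) (y : ℝ) {x₁ x₂ : ℝ} (hx : x₁ ≤ x₂) :
    value c1 c2 r D h y x₂ ≤ value c1 c2 r D h y x₁ + ((r * (x₂ - x₁) : ℝ) : EReal) := by
  refine value_le_add_of_forall_strategy fun α hα => ?_
  have hdyn : ∀ p, dyn x₂ y p (α.act p).1 ((α.act p).2.addConst (x₂ - x₁) (sub_nonneg.2 hx)) =
      dyn x₁ y p (α.act p).1 (α.act p).2 := fun p => by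
    ext t; simp only [dyn, IncE.addConst]; ring
  refine ⟨⟨fun p => ((α.act p).1, (α.act p).2.addConst (x₂ - x₁) (sub_nonneg.2 hx)),
    fun p q t ht hpq s hs => ⟨(α.causal p q t ht hpq s hs).1,
      congrArg (· + (x₂ - x₁)) (α.causal p q t ht hpq s hs).2⟩⟩, fun p t ht => ?_,
    fun p T hT => ?_⟩
  · rw [hdyn p]; exact hα p t ht
  · simp only [cost, hdyn p]
    exact le_of_eq (by simp only [IncE.addConst]; ring)

lemma dyn_congr {x y t s : ℝ} {α : Strategy} {p q : PathControl} (ht : 0 ≤ t)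
    (hpq : AgreeUpTo p q t) (hs : s ∈ Icc 0 t) :
    dyn x y p (α.act p).1 (α.act p).2 s = dyn x y q (α.act q).1 (α.act q).2 s := by
  have hnet : netInput p s = netInput q s :=
    setIntegral_congr_of_agree hpq hs.2 fun a b => a - b
  simp only [dyn, (α.causal p q t ht hpq s hs).1, (α.causal p q t ht hpq s hs).2, hnet]

/-- Reflecting the path started from `x₁` at `0` keeps it below the path started from `x₂`. -/
lemma value_mono {c1 c2 y r D : ℝ} (hD : 0 ≤ D) {h : ℝ → ℝ} (hcont : ContinuousOn h (Icc 0 D))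
    (hmono : MonotoneOn h (Icc 0 D)) {x₁ x₂ : ℝ} (hx : x₁ ≤ x₂) :
    value c1 c2 r D h y x₁ ≤ value c1 c2 r D h y x₂ := by
  suffices value c1 c2 r D h y x₁ ≤ value c1 c2 r D h y x₂ + ((0 : ℝ) : EReal) by simpa using this
  refine value_le_add_of_forall_strategy fun α hα => ?_
  set φ : PathControl → ℝ → ℝ := fun p => dyn x₂ y p (α.act p).1 (α.act p).2 with hφ
  let g : PathControl → ℝ → ℝ := fun p t => max (x₂ - x₁ - φ p t) 0
  have hgB : ∀ p t, 0 ≤ t → g p t ≤ x₂ - x₁ := fun p t ht =>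
    max_le (by linarith [(hα p t ht).1]) (sub_nonneg.2 hx)
  let L : PathControl → IncE := fun p => IncE.runningSup (g p) (x₂ - x₁)
    (fun t => le_max_right _ _) (hgB p) fun t ht =>
      (continuousWithinAt_const.sub (continuousWithinAt_dyn x₂ y p _ _ ht)).max
        continuousWithinAt_const
  let β : Strategy := ⟨fun p => ((α.act p).1.add (L p), (α.act p).2), fun p q t ht hpq s hs => by
    refine ⟨congrArg₂ (· + ·) (α.causal p q t ht hpq s hs).1 (congrArg sSup (image_congr ?_)),
      (α.causal p q t ht hpq s hs).2⟩
    intro u hu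
    simp only [g, hφ, dyn_congr ht hpq ⟨hu.1, hu.2.trans hs.2⟩]⟩
  have hdyn : ∀ p t, dyn x₁ y p (β.act p).1 (β.act p).2 t =
      φ p t - (x₂ - x₁) + (L p).f t := fun p t => by
    simp only [hφ, dyn, β, IncE.add]; ring
  have hLB : ∀ p t, 0 ≤ t → (L p).f t ≤ x₂ - x₁ := fun p t ht =>
    sSup_image_Icc_le ht fun s hs _ => hgB p s hs
  have hle : ∀ p t, 0 ≤ t → dyn x₁ y p (β.act p).1 (β.act p).2 t ≤ φ p t := fun p t ht => by
    rw [hdyn]; linarith [hLB p t ht]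
  have hβ : Admissible D x₁ y β := fun p t ht => by
    refine ⟨?_, (hle p t ht).trans (hα p t ht).2⟩
    have h1 : g p t ≤ (L p).f t := le_sSup_image_Icc (hgB p) ht le_rfl
    have h2 : x₂ - x₁ - φ p t ≤ g p t := le_max_left _ _
    rw [hdyn]; linarith
  refine ⟨β, hβ, fun p T hT => ?_⟩
  have hint : ∫ t in Ioc (0:ℝ) T, h (dyn x₁ y p (β.act p).1 (β.act p).2 t) ≤
      ∫ t in Ioc (0:ℝ) T, h (φ p t) :=
    setIntegral_mono_on (integrableOn_comp_dyn hcont hD (hβ p) T)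
      (integrableOn_comp_dyn hcont hD (hα p) T) measurableSet_Ioc fun t ht =>
        hmono (hβ p t ht.1.le) (hα p t ht.1.le) (hle p t ht.1.le)
  simp only [cost]
  linarith

lemma mul_posPart_le_rate {c1 c2 y r : ℝ} (hc1 : 0 < c1) (hc2 : 0 < c2) (hr : 0 < r)
    (hy : r / (4 * (c1⁻¹ + c2⁻¹)⁻¹) ≤ -y) (a b : ℝ) :
    r * max (a - b + y) 0 ≤ c1 * a ^ 2 + c2 * b ^ 2 := by
  have hnn : 0 ≤ c1 * a ^ 2 + c2 * b ^ 2 := by positivity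
  rcases le_total (a - b + y) 0 with hq | hq
  · rwa [max_eq_right hq, mul_zero]
  · rw [max_eq_left hq]
    have hy' : r * (r / 4 * (c1⁻¹ + c2⁻¹)) ≤ r * -y := by
      refine mul_le_mul_of_nonneg_left (le_trans (le_of_eq ?_) hy) hr.le
      field_simp
    have e1 : c1 * a ^ 2 - r * a + r ^ 2 / 4 * c1⁻¹ = c1 * (a - r / (2 * c1)) ^ 2 := by
      field_simp; ring
    have e2 : c2 * b ^ 2 + r * b + r ^ 2 / 4 * c2⁻¹ = c2 * (b + r / (2 * c2)) ^ 2 := by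
      field_simp; ring
    have p1 : 0 ≤ c1 * (a - r / (2 * c1)) ^ 2 := by positivity
    have p2 : 0 ≤ c2 * (b + r / (2 * c2)) ^ 2 := by positivity
    nlinarith

/-- Keeping the path at `0` costs nothing. -/
lemma value_zero_le {c1 c2 y r D : ℝ} (hc1 : 0 < c1) (hc2 : 0 < c2) (hr : 0 < r) (hD : 0 ≤ D)
    {h : ℝ → ℝ} (h0 : h 0 = 0) (hy : r / (4 * (c1⁻¹ + c2⁻¹)⁻¹) ≤ -y) :
    value c1 c2 r D h y 0 ≤ 0 := by
  have hint : ∀ (p : PathControl) (T : ℝ),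
      IntegrableOn (fun t => p.p1 t - p.p2 t + y) (Ioc 0 T) := fun p T =>
    (p.integrableOn_sub T).add (by simp : IntegrableOn (fun _ => y) (Ioc 0 T))
  have hpos : ∀ (p : PathControl) (T : ℝ),
      IntegrableOn (fun t => max (p.p1 t - p.p2 t + y) 0) (Ioc 0 T) := fun p T => (hint p T).pos_part
  have hneg : ∀ (p : PathControl) (T : ℝ),
      IntegrableOn (fun t => max (-(p.p1 t - p.p2 t + y)) 0) (Ioc 0 T) :=
    fun p T => (hint p T).neg_part
  let α : Strategy := ⟨fun p => (IncE.primitive _ (hneg p) fun t => le_max_right _ _,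
    IncE.primitive _ (hpos p) fun t => le_max_right _ _), fun p q t ht hpq s hs =>
      ⟨setIntegral_congr_of_agree hpq hs.2 fun a b => max (-(a - b + y)) 0,
        setIntegral_congr_of_agree hpq hs.2 fun a b => max (a - b + y) 0⟩⟩
  have hdyn : ∀ p t, 0 ≤ t → dyn 0 y p (α.act p).1 (α.act p).2 t = 0 := fun p t ht => by
    have h1 : ∫ s in Ioc (0:ℝ) t, (p.p1 s - p.p2 s + y) = netInput p t + y * t := by
      rw [integral_add (p.integrableOn_sub t) (by simp), netInput]
      simp [ht, mul_comm]
    have h2 : ∫ s in Ioc (0:ℝ) t, (p.p1 s - p.p2 s + y) =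
        (∫ s in Ioc (0:ℝ) t, max (p.p1 s - p.p2 s + y) 0) -
          ∫ s in Ioc (0:ℝ) t, max (-(p.p1 s - p.p2 s + y)) 0 := by
      rw [← integral_sub (hpos p t) (hneg p t)]
      congr 1 with s
      exact (max_zero_sub_max_neg_zero_eq_self _).symm
    simp only [dyn, α, IncE.primitive]
    linarith
  refine value_le_of_strategy (α := α) (fun p t ht => ?_) fun p T hT => ?_
  · rw [hdyn p t ht]; exact ⟨le_rfl, hD⟩
  · have h1 : ∫ t in Ioc (0:ℝ) T, h (dyn 0 y p (α.act p).1 (α.act p).2 t) = 0 :=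
      setIntegral_eq_zero_of_forall_eq_zero fun t ht => by rw [hdyn p t ht.1.le, h0]
    have h2 : r * (α.act p).2.f T ≤ rateCost c1 c2 p T := by
      simp only [α, IncE.primitive, rateCost]
      rw [← integral_const_mul]
      exact integral_mono ((hpos p T).const_mul r)
        (((p.sq1 T).const_mul c1).add ((p.sq2 T).const_mul c2))
        fun t => mul_posPart_le_rate hc1 hc2 hr hy _ _
    have h3 : cost c1 c2 r h 0 y p (α.act p).1 (α.act p).2 T ≤ 0 := by
      simp only [cost, h1]; linarith
    exact_mod_cast h3

lemma continuousOn_of_monotone_of_le_add {V : ℝ → EReal} {s : Set ℝ} {r : ℝ}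
    (hbot : ∀ x ∈ s, V x ≠ ⊥) (htop : ∀ x ∈ s, V x ≠ ⊤)
    (hmono : ∀ x ∈ s, ∀ z ∈ s, x ≤ z → V x ≤ V z)
    (hadd : ∀ x ∈ s, ∀ z ∈ s, x ≤ z → V z ≤ V x + ((r * (z - x) : ℝ) : EReal)) :
    ContinuousOn V s := by
  have hcoe : ∀ x ∈ s, ((V x).toReal : EReal) = V x := fun x hx =>
    EReal.coe_toReal (htop x hx) (hbot x hx)
  have key : ∀ x ∈ s, ∀ z ∈ s, x ≤ z → |(V z).toReal - (V x).toReal| ≤ |r| * |z - x| := by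
    intro x hx z hz hxz
    have h1 := hmono x hx z hz hxz
    have h2 := hadd x hx z hz hxz
    rw [← hcoe x hx, ← hcoe z hz] at h1 h2
    rw [EReal.coe_le_coe_iff] at h1
    rw [← EReal.coe_add, EReal.coe_le_coe_iff] at h2
    rw [← abs_mul, abs_of_nonneg (sub_nonneg.2 h1)]
    exact le_trans (by linarith) (le_abs_self _)
  have hlip : LipschitzOnWith (Real.nnabs r) (fun x => (V x).toReal) s := by
    refine LipschitzOnWith.of_dist_le_mul fun x hx z hz => ?_
    simp only [Real.dist_eq, Real.coe_nnabs]
    rcases le_total x z with hxz | hxz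
    · rw [abs_sub_comm, abs_sub_comm x z]; exact key x hx z hz hxz
    · exact key z hz x hx hxz
  exact (continuous_coe_real_ereal.comp_continuousOn hlip.continuousOn).congr fun x hx =>
    (hcoe x hx).symm

/-- if `−y ≥ r/(4c)` then `0 ≤ V(x) ≤ r·x` for every `x ∈ [0,D]`
(in particular `V(0) = 0`), `V` is nondecreasing on `[0,D]`, and `V` is continuous
on `[0,D]`. -/
theorem stmt1 (c1 c2 y r D : ℝ) (hc1 : 0 < c1) (hc2 : 0 < c2) (hr : 0 < r) (hD : 0 < D)
    (h : ℝ → ℝ) (hcont : ContinuousOn h (Icc 0 D)) (hmono : StrictMonoOn h (Icc 0 D))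
    (hnn : ∀ u ∈ Icc (0:ℝ) D, 0 ≤ h u) (h0 : h 0 = 0)
    (c : ℝ) (hc : c = (c1⁻¹ + c2⁻¹)⁻¹)
    (hy : r / (4 * c) ≤ -y) :
    (∀ x ∈ Icc (0:ℝ) D,
        (0 : EReal) ≤ value c1 c2 r D h y x ∧ value c1 c2 r D h y x ≤ ((r * x : ℝ) : EReal))
      ∧ value c1 c2 r D h y 0 = 0
      ∧ (∀ x₁ ∈ Icc (0:ℝ) D, ∀ x₂ ∈ Icc (0:ℝ) D, x₁ ≤ x₂ →
          value c1 c2 r D h y x₁ ≤ value c1 c2 r D h y x₂)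
      ∧ ContinuousOn (fun x => value c1 c2 r D h y x) (Icc (0:ℝ) D) := by
  subst hc
  have hnonneg := value_nonneg c1 c2 r D hr h y
  have hzero : value c1 c2 r D h y 0 = 0 :=
    le_antisymm (value_zero_le hc1 hc2 hr hD.le h0 hy) (hnonneg 0)
  have hupper : ∀ x ∈ Icc (0:ℝ) D, value c1 c2 r D h y x ≤ ((r * x : ℝ) : EReal) := fun x hx => by
    simpa [hzero] using value_le_value_add c1 c2 r D h y hx.1
  have hmon : ∀ x₁ ∈ Icc (0:ℝ) D, ∀ x₂ ∈ Icc (0:ℝ) D, x₁ ≤ x₂ →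
      value c1 c2 r D h y x₁ ≤ value c1 c2 r D h y x₂ := fun _ _ _ _ hx =>
    value_mono hD.le hcont hmono.monotoneOn hx
  refine ⟨fun x hx => ⟨hnonneg x, hupper x hx⟩, hzero, hmon, ?_⟩
  exact continuousOn_of_monotone_of_le_add
    (fun x _ => ne_of_gt (EReal.bot_lt_zero.trans_le (hnonneg x)))
    (fun x hx => ne_of_lt ((hupper x hx).trans_lt (EReal.coe_lt_top _)))
    hmon fun _ _ _ _ hx => value_le_value_add c1 c2 r D h y hx
end
end

section
/- (Comparison principle / uniqueness.) Suppose −y ≥ r/(4c). Let u, v : [0,D] → ℝ be continuous with u(0) = v(0) = 0. If u is a viscosity subsolution of the Bellman equation max{ −f′(x)²/(4c) − y f′(x) − h(x), f′(x) − r } = 0 on (0,D) and v is a viscosity supersolution of that equation on (0,D], then u(x) ≤ v(x) for all x ∈ [0,D]. In particular, the Bellman equation has at most one viscosity solution on [0,D]. -/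
open Set

noncomputable section

/-- The Bellman-equation Hamiltonian `max{ −q²/(4c) − y q − h(x), q − r }`. -/
def ham (c y r : ℝ) (h : ℝ → ℝ) (x q : ℝ) : ℝ :=
  max (-(q ^ 2) / (4 * c) - y * q - h x) (q - r)

/-- Viscosity subsolution of the Bellman equation on `B ⊆ [0,D]`. -/
def IsViscositySubsol (c y r D : ℝ) (h f : ℝ → ℝ) (B : Set ℝ) : Prop :=
  ∀ x ∈ B, ∀ φ : ℝ → ℝ, ContDiffOn ℝ 1 φ (Icc 0 D) →
    (∀ z ∈ B, f z - φ z ≤ f x - φ x) →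
    ham c y r h x (derivWithin φ (Icc 0 D) x) ≤ 0

/-- Viscosity supersolution of the Bellman equation on `B ⊆ [0,D]`. -/
def IsViscositySupersol (c y r D : ℝ) (h f : ℝ → ℝ) (B : Set ℝ) : Prop :=
  ∀ x ∈ B, ∀ φ : ℝ → ℝ, ContDiffOn ℝ 1 φ (Icc 0 D) →
    (∀ z ∈ B, f x - φ x ≤ f z - φ z) →
    0 ≤ ham c y r h x (derivWithin φ (Icc 0 D) x)

open Filter Topology

lemma antitoneOn_Icc_of_Ioo {α β : ℝ} {w : ℝ → ℝ} (hw : ContinuousOn w (Icc α β))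
    (h : AntitoneOn w (Ioo α β)) : AntitoneOn w (Icc α β) := by
  have hright : ∀ a ∈ Ioo α β, ∀ b ∈ Icc a β, w b ≤ w a := by
    intro a ha b hb
    rw [← closure_Ioo ha.2.ne] at hb
    refine le_on_closure (fun z hz => h ha ⟨ha.1.trans hz.1, hz.2⟩ hz.1.le) (hw.mono ?_)
      continuousOn_const hb
    rw [closure_Ioo ha.2.ne]
    exact Icc_subset_Icc_left ha.1.le
  intro a ha b hb hab
  rcases hab.eq_or_lt with rfl | hab
  · exact le_rfl
  have hα : α < b := ha.1.trans_lt hab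
  have ha' : a ∈ closure (Ioo α b) := by rw [closure_Ioo hα.ne]; exact ⟨ha.1, hab.le⟩
  refine le_on_closure (fun z hz => hright z ⟨hz.1, hz.2.trans_le hb.2⟩ b ⟨hz.2.le, hb.2⟩)
    continuousOn_const (hw.mono ?_) ha'
  rw [closure_Ioo hα.ne]
  exact Icc_subset_Icc_right hb.2

/-- A `C¹` function touching `f` from above near `x` can be modified, without changing its
derivative at `x`, so as to touch `f` from above on the whole interval. -/
lemma exists_global_touching {D : ℝ} {f φ : ℝ → ℝ} (hf : ContinuousOn f (Icc 0 D))
    (hφ : ContDiffOn ℝ 1 φ (Icc 0 D)) {x δ : ℝ} (hx : x ∈ Icc 0 D) (hδ : 0 < δ)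
    (hloc : ∀ z ∈ Icc 0 D, |z - x| < δ → f z - φ z ≤ f x - φ x) :
    ∃ ψ : ℝ → ℝ, ContDiffOn ℝ 1 ψ (Icc 0 D) ∧
      derivWithin ψ (Icc 0 D) x = derivWithin φ (Icc 0 D) x ∧
      ∀ z ∈ Icc 0 D, f z - ψ z ≤ f x - ψ x := by
  obtain ⟨M, hM⟩ := isCompact_Icc.bddAbove_image (hf.sub hφ.continuousOn)
  have hM' : ∀ z ∈ Icc 0 D, f z - φ z ≤ M := fun z hz => hM ⟨z, hz, rfl⟩
  set K := (M - (f x - φ x)) / δ ^ 2 with hK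
  have hKδ : K * δ ^ 2 = M - (f x - φ x) := by rw [hK]; field_simp
  have hK0 : 0 ≤ K := div_nonneg (sub_nonneg.2 (hM' x hx)) (by positivity)
  refine ⟨fun z => φ z + K * (z - x) ^ 2, hφ.add (by fun_prop), ?_, fun z hz => ?_⟩
  · have h1 : HasDerivWithinAt (fun z : ℝ => K * (z - x) ^ 2) 0 (Icc 0 D) x := by
      have := ((((hasDerivAt_id x).sub_const x).pow 2).const_mul K).hasDerivWithinAt (s := Icc 0 D)
      simpa using this
    by_cases hu : UniqueDiffWithinAt ℝ (Icc 0 D) x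
    · have h2 := ((hφ.differentiableOn one_ne_zero) x hx).hasDerivWithinAt
      exact (h2.add h1).derivWithin hu |>.trans (add_zero _)
    · rw [derivWithin_zero_of_not_uniqueDiffWithinAt hu,
        derivWithin_zero_of_not_uniqueDiffWithinAt hu]
  · simp only [sub_self, ne_eq, OfNat.ofNat_ne_zero, not_false_eq_true, zero_pow, mul_zero,
      add_zero]
    by_cases hzx : |z - x| < δ
    · nlinarith [hloc z hz hzx, mul_nonneg hK0 (sq_nonneg (z - x))]
    · have h3 : δ ^ 2 ≤ (z - x) ^ 2 := sq_le_sq.2 (by rw [abs_of_pos hδ]; exact not_lt.1 hzx)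
      nlinarith [hM' z hz, mul_le_mul_of_nonneg_left h3 hK0]

/-- A continuous function on `[0,D]` whose upper test functions at points of `(α,β)` have slope
at most `Q` decreases on `[α,β]` relative to a primitive `G` of `Q`. -/
lemma antitoneOn_sub_of_touching_slope_le {D α β : ℝ} (hα : 0 ≤ α) (hβ : β ≤ D)
    {f G Q : ℝ → ℝ} (hf : ContinuousOn f (Icc 0 D)) (hQ : Continuous Q)
    (hG : ∀ x, HasDerivAt G (Q x) x)
    (htouch : ∀ x ∈ Ioo α β, ∀ φ : ℝ → ℝ, ContDiffOn ℝ 1 φ (Icc 0 D) →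
      (∀ z ∈ Icc 0 D, f z - φ z ≤ f x - φ x) → derivWithin φ (Icc 0 D) x ≤ Q x) :
    AntitoneOn (fun x => f x - G x) (Icc α β) := by
  have hG1 : ContDiff ℝ 1 G := by
    refine contDiff_one_iff_deriv.2 ⟨fun x => (hG x).differentiableAt, ?_⟩
    rwa [show deriv G = Q from funext fun x => (hG x).deriv]
  have hw : ContinuousOn (fun x => f x - G x) (Icc 0 D) := hf.sub hG1.continuous.continuousOn
  have hopen : AntitoneOn (fun x => f x - G x) (Ioo α β) := by
    intro s hs t ht hst
    by_contra! hlt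
    have hst' : s < t := hst.lt_of_ne (by rintro rfl; exact lt_irrefl _ hlt)
    obtain ⟨T, htT, hTβ⟩ := exists_between ht.2
    have hsub : Icc s T ⊆ Icc 0 D :=
      Icc_subset_Icc (hα.trans hs.1.le) (hTβ.le.trans hβ)
    set ε := ((f t - G t) - (f s - G s)) / 2 with hε
    have hε0 : 0 < ε := by linarith
    have hTt : 0 < T - t := sub_pos.2 htT
    set K := (|(f T - G T) - (f t - G t)| + 1) / (ε * (T - t)) with hK
    have hK0 : 0 < K := by positivity
    have hKe : ε * (K * (T - t)) = |(f T - G T) - (f t - G t)| + 1 := by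
      rw [hK]; field_simp
    set φ : ℝ → ℝ := fun z => G z + ε * Real.exp (K * (z - t)) with hφ
    have hφd : ∀ x, HasDerivAt φ (Q x + ε * (Real.exp (K * (x - t)) * K)) x := by
      intro x
      have h1 : HasDerivAt (fun z => K * (z - t)) K x := by
        simpa using ((hasDerivAt_id x).sub_const t).const_mul K
      exact (hG x).add (h1.exp.const_mul ε)
    have hφ1 : ContDiff ℝ 1 φ := hG1.add (by fun_prop)
    obtain ⟨x, hx, hmax⟩ := isCompact_Icc.exists_isMaxOn (nonempty_Icc.2 (hst.trans htT.le))
      ((hf.mono hsub).sub hφ1.continuous.continuousOn)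
    have hmax' : ∀ z ∈ Icc s T, f z - φ z ≤ f x - φ x := fun z hz => hmax hz
    have hmt := hmax' t ⟨hst, htT.le⟩
    have hφt : φ t = G t + ε := by simp [hφ]
    have hxs : s < x := by
      refine hx.1.lt_of_ne ?_
      rintro rfl
      have : 0 < ε * Real.exp (K * (s - t)) := by positivity
      simp only [hφ] at hmt hφt
      linarith
    have hxT : x < T := by
      refine hx.2.lt_of_ne ?_
      rintro rfl
      have h1 := mul_le_mul_of_nonneg_left (Real.add_one_le_exp (K * (x - t))) hε0.le
      have h2 := le_abs_self ((f x - G x) - (f t - G t))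
      simp only [hφ] at hmt hφt
      linarith
    have hxI : x ∈ Ioo α β := ⟨hs.1.trans hxs, hxT.trans hTβ⟩
    obtain ⟨ψ, hψ, hψd, hψm⟩ := exists_global_touching hf hφ1.contDiffOn (hsub hx)
      (lt_min (sub_pos.2 hxs) (sub_pos.2 hxT)) (fun z _ hz => hmax' z (by
        rw [lt_min_iff, abs_lt, abs_lt] at hz
        constructor <;> linarith [hz.1.1, hz.2.2]))
    have hslope := htouch x hxI ψ hψ hψm
    have hD : 0 < D := (hα.trans_lt (hxI.1.trans hxI.2)).trans_le hβ
    rw [hψd, (hφd x).hasDerivWithinAt.derivWithin (uniqueDiffOn_Icc hD x (hsub hx))] at hslope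
    have : 0 < ε * (Real.exp (K * (x - t)) * K) := by positivity
    linarith
  exact antitoneOn_Icc_of_Ioo (hw.mono (Icc_subset_Icc hα hβ)) hopen

lemma monotoneOn_sub_of_touching_slope_ge {D α β : ℝ} (hα : 0 ≤ α) (hβ : β ≤ D)
    {f G Q : ℝ → ℝ} (hf : ContinuousOn f (Icc 0 D)) (hQ : Continuous Q)
    (hG : ∀ x, HasDerivAt G (Q x) x)
    (htouch : ∀ x ∈ Ioo α β, ∀ φ : ℝ → ℝ, ContDiffOn ℝ 1 φ (Icc 0 D) →
      (∀ z ∈ Icc 0 D, f x - φ x ≤ f z - φ z) → Q x ≤ derivWithin φ (Icc 0 D) x) :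
    MonotoneOn (fun x => f x - G x) (Icc α β) := by
  have hanti := antitoneOn_sub_of_touching_slope_le (f := -f) (G := -G) (Q := -Q) hα hβ hf.neg
    hQ.neg (fun x => (hG x).neg) (fun x hx φ hφ hm => by
      have := htouch x hx (-φ) hφ.neg (fun z hz => by
        have := hm z hz
        simp only [Pi.neg_apply] at this ⊢
        linarith)
      rw [derivWithin.neg] at this
      simp only [Pi.neg_apply] at this ⊢
      linarith)
  intro a ha b hb hab
  have := hanti ha hb hab
  simp only [Pi.neg_apply] at this ⊢
  linarith

/-- Where `F(r) > h(x)`, with `F(q) = −q²/(4c) − y q`, the sign of the Hamiltonian switches at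
the smaller root of `F(q) = h(x)`. -/
lemma ham_neg_of_lt_root {c y r q x : ℝ} {h : ℝ → ℝ} (hc : 0 < c)
    (hx : h x < -(r ^ 2) / (4 * c) - y * r)
    (hq : q < -(2 * c * y) - √((2 * c * y) ^ 2 - 4 * c * h x)) : ham c y r h x q < 0 := by
  have hF : ∀ p, -(p ^ 2) / (4 * c) - y * p - h x
      = (((2 * c * y) ^ 2 - 4 * c * h x) - (p + 2 * c * y) ^ 2) / (4 * c) := by
    intro p; field_simp; ring
  have hr : (r + 2 * c * y) ^ 2 < (2 * c * y) ^ 2 - 4 * c * h x := by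
    have := sub_pos.2 hx
    rw [hF, div_pos_iff_of_pos_right (by positivity)] at this
    linarith
  have hrS := abs_lt.1 (Real.lt_sqrt_of_sq_lt ((sq_abs _).trans_lt hr))
  refine max_lt ?_ (by linarith)
  rw [hF]
  refine div_neg_of_neg_of_pos ?_ (by positivity)
  have hS := Real.sqrt_nonneg ((2 * c * y) ^ 2 - 4 * c * h x)
  have hS2 := Real.sq_sqrt ((sq_nonneg _).trans hr.le)
  nlinarith

lemma ham_pos_of_root_lt {c y r q x : ℝ} {h : ℝ → ℝ} (hc : 0 < c)
    (hx : h x < -(r ^ 2) / (4 * c) - y * r)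
    (hq : -(2 * c * y) - √((2 * c * y) ^ 2 - 4 * c * h x) < q) : 0 < ham c y r h x q := by
  have hF : ∀ p, -(p ^ 2) / (4 * c) - y * p - h x
      = (((2 * c * y) ^ 2 - 4 * c * h x) - (p + 2 * c * y) ^ 2) / (4 * c) := by
    intro p; field_simp; ring
  have hr : (r + 2 * c * y) ^ 2 < (2 * c * y) ^ 2 - 4 * c * h x := by
    have := sub_pos.2 hx
    rw [hF, div_pos_iff_of_pos_right (by positivity)] at this
    linarith
  have hrS := abs_lt.1 (Real.lt_sqrt_of_sq_lt ((sq_abs _).trans_lt hr))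
  rcases lt_or_ge r q with hrq | hqr
  · exact lt_max_of_lt_right (sub_pos.2 hrq)
  · refine lt_max_of_lt_left ?_
    rw [hF]
    refine div_pos ?_ (by positivity)
    have hS2 := Real.sq_sqrt ((sq_nonneg _).trans hr.le)
    nlinarith

/-- Below the threshold `h = F(r)`, a subsolution grows no faster than a supersolution. -/
lemma antitoneOn_sub_of_lt {c y r D β : ℝ} {h u v : ℝ → ℝ} (hc : 0 < c) (hD : 0 < D)
    (hcont : ContinuousOn h (Icc 0 D)) (hβ : β ≤ D)
    (hu : ContinuousOn u (Icc 0 D)) (hv : ContinuousOn v (Icc 0 D))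
    (hsub : IsViscositySubsol c y r D h u (Ioo 0 D))
    (hsup : IsViscositySupersol c y r D h v (Ioc 0 D))
    (hlow : ∀ x ∈ Ioo 0 β, h x < -(r ^ 2) / (4 * c) - y * r) :
    AntitoneOn (fun x => u x - v x) (Icc 0 β) := by
  set H : ℝ → ℝ := IccExtend hD.le ((Icc 0 D).domRestrict h) with hH
  have hHc : Continuous H := (continuousOn_iff_continuous_domRestrict.1 hcont).Icc_extend'
  have hHh : ∀ x ∈ Icc 0 D, H x = h x := fun x hx => IccExtend_of_mem hD.le _ hx
  set Q : ℝ → ℝ := fun x => -(2 * c * y) - √((2 * c * y) ^ 2 - 4 * c * H x) with hQdef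
  have hQ : Continuous Q := by fun_prop
  have hQh : ∀ x ∈ Icc 0 D, Q x = -(2 * c * y) - √((2 * c * y) ^ 2 - 4 * c * h x) :=
    fun x hx => by simp only [hQdef, hHh x hx]
  have hG : ∀ x, HasDerivAt (fun x => ∫ t in (0 : ℝ)..x, Q t) (Q x) x :=
    fun x => (hQ.integral_hasStrictDerivAt 0 x).hasDerivAt
  have hanti := antitoneOn_sub_of_touching_slope_le le_rfl hβ hu hQ hG
    (fun x hx φ hφ hm => by
      by_contra! hlt
      rw [hQh x ⟨hx.1.le, hx.2.le.trans hβ⟩] at hlt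
      exact absurd (hsub x ⟨hx.1, hx.2.trans_le hβ⟩ φ hφ
        (fun z hz => hm z (Ioo_subset_Icc_self hz)))
        (ham_pos_of_root_lt hc (hlow x hx) hlt).not_ge)
  have hmono := monotoneOn_sub_of_touching_slope_ge le_rfl hβ hv hQ hG
    (fun x hx φ hφ hm => by
      by_contra! hlt
      rw [hQh x ⟨hx.1.le, hx.2.le.trans hβ⟩] at hlt
      exact absurd (hsup x ⟨hx.1, hx.2.le.trans hβ⟩ φ hφ
        (fun z hz => hm z (Ioc_subset_Icc_self hz)))
        (ham_neg_of_lt_root hc (hlow x hx) hlt).not_ge)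
  intro a ha b hb hab
  have h1 := hanti ha hb hab
  have h2 := hmono ha hb hab
  simp only at h1 h2 ⊢
  linarith

/-- Above the threshold `h = F(r)`, the boundary condition at `D` forces a supersolution to grow
with slope at least `r`. -/
lemma supersol_slope_ge {c y r D α : ℝ} {h v : ℝ → ℝ} (hα : 0 ≤ α)
    (hmono : StrictMonoOn h (Icc 0 D)) (hv : ContinuousOn v (Icc 0 D))
    (hsup : IsViscositySupersol c y r D h v (Ioc 0 D))
    (hhigh : ∀ x ∈ Ioc α D, -(r ^ 2) / (4 * c) - y * r < h x)
    {s t : ℝ} (hs : s ∈ Ioc α D) (ht : t ∈ Icc s D) : v s - r * s ≤ v t - r * t := by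
  have hs0 : 0 < s := hα.trans_lt hs.1
  have hsub : Icc s D ⊆ Icc 0 D := Icc_subset_Icc_left hs0.le
  have hFc : Continuous fun p : ℝ => -(p ^ 2) / (4 * c) - y * p := by fun_prop
  have hev : ∀ᶠ p in 𝓝[<] r, v s - p * s ≤ v t - p * t := by
    filter_upwards [(hFc.tendsto r |>.mono_left nhdsWithin_le_nhds).eventually_lt_const
      (hhigh s hs), self_mem_nhdsWithin] with p hp hpr
    have hlin : ContDiff ℝ 1 fun z : ℝ => p * z := by fun_prop
    obtain ⟨x, hx, hmin⟩ := isCompact_Icc.exists_isMinOn (nonempty_Icc.2 hs.2)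
      ((hv.mono hsub).sub hlin.continuous.continuousOn)
    have hmin' : ∀ z ∈ Icc s D, v x - p * x ≤ v z - p * z := fun z hz => hmin hz
    rcases hx.1.eq_or_lt with rfl | hsx
    · exact hmin' t ht
    obtain ⟨ψ, hψ, hψd, hψm⟩ := exists_global_touching hv.neg hlin.neg.contDiffOn (hsub hx)
      (sub_pos.2 hsx) (fun z hz hzx => by
        have := hmin' z ⟨by linarith [(abs_lt.1 hzx).1], hz.2⟩
        simp only [Pi.neg_apply]
        linarith)
    have hham := hsup x ⟨hs0.trans hsx, hx.2⟩ (-ψ) hψ.neg (fun z hz => by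
      have := hψm z (Ioc_subset_Icc_self hz)
      simp only [Pi.neg_apply] at this ⊢
      linarith)
    have hd : HasDerivAt (fun z : ℝ => -(p * z)) (-p) x := by
      simpa using (hasDerivAt_id x).const_mul (-p)
    rw [derivWithin.neg, hψd, hd.hasDerivWithinAt.derivWithin
      (uniqueDiffOn_Icc (hs0.trans_le hs.2) x (hsub hx)), neg_neg] at hham
    have hhx := hmono (hsub ⟨le_rfl, hs.2⟩) (hsub hx) hsx
    exact absurd hham (max_lt (by linarith) (sub_neg.2 hpr)).not_ge
  refine le_of_tendsto_of_tendsto ?_ ?_ hev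
  · exact Tendsto.mono_left (Continuous.tendsto (f := fun p => v s - p * s) (by fun_prop) r)
      nhdsWithin_le_nhds
  · exact Tendsto.mono_left (Continuous.tendsto (f := fun p => v t - p * t) (by fun_prop) r)
      nhdsWithin_le_nhds

/-- Above the threshold `h = F(r)`, a subsolution grows no faster than a supersolution. -/
lemma antitoneOn_sub_of_gt {c y r D α : ℝ} {h u v : ℝ → ℝ} (hα : 0 ≤ α)
    (hmono : StrictMonoOn h (Icc 0 D))
    (hu : ContinuousOn u (Icc 0 D)) (hv : ContinuousOn v (Icc 0 D))
    (hsub : IsViscositySubsol c y r D h u (Ioo 0 D))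
    (hsup : IsViscositySupersol c y r D h v (Ioc 0 D))
    (hhigh : ∀ x ∈ Ioc α D, -(r ^ 2) / (4 * c) - y * r < h x) :
    AntitoneOn (fun x => u x - v x) (Icc α D) := by
  have hanti := antitoneOn_sub_of_touching_slope_le (G := fun x => r * x) (Q := fun _ => r)
    hα le_rfl hu continuous_const (fun x => by simpa using (hasDerivAt_id x).const_mul r)
    (fun x hx φ hφ hm => sub_nonpos.1 ((le_max_right _ _).trans
      (hsub x ⟨hα.trans_lt hx.1, hx.2⟩ φ hφ (fun z hz => hm z (Ioo_subset_Icc_self hz)))))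
  refine antitoneOn_Icc_of_Ioo ((hu.sub hv).mono (Icc_subset_Icc_left hα)) ?_
  intro a ha b hb hab
  have h1 := hanti (Ioo_subset_Icc_self ha) (Ioo_subset_Icc_self hb) hab
  have h2 := supersol_slope_ge hα hmono hv hsup hhigh (Ioo_subset_Ioc_self ha) ⟨hab, hb.2.le⟩
  simp only at h1 ⊢
  linarith

/-- comparison principle / uniqueness: if `−y ≥ r/(4c)`, `u, v` are
continuous on `[0,D]` with `u(0) = v(0) = 0`, `u` is a viscosity subsolution of the
Bellman equation on `(0,D)` and `v` is a viscosity supersolution on `(0,D]`, then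
`u ≤ v` on `[0,D]`. -/
theorem stmt4 (c1 c2 y r D : ℝ) (hc1 : 0 < c1) (hc2 : 0 < c2) (hr : 0 < r) (hD : 0 < D)
    (h : ℝ → ℝ) (hcont : ContinuousOn h (Icc 0 D)) (hmono : StrictMonoOn h (Icc 0 D))
    (hnn : ∀ u ∈ Icc (0:ℝ) D, 0 ≤ h u) (h0 : h 0 = 0)
    (c : ℝ) (hc : c = (c1⁻¹ + c2⁻¹)⁻¹)
    (hy : r / (4 * c) ≤ -y)
    (u v : ℝ → ℝ) (hu : ContinuousOn u (Icc 0 D)) (hv : ContinuousOn v (Icc 0 D))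
    (hu0 : u 0 = 0) (hv0 : v 0 = 0)
    (hsub : IsViscositySubsol c y r D h u (Ioo 0 D))
    (hsup : IsViscositySupersol c y r D h v (Ioc 0 D)) :
    ∀ x ∈ Icc (0:ℝ) D, u x ≤ v x := by
  have hc0 : 0 < c := by rw [hc]; positivity
  have hFr : 0 ≤ -(r ^ 2) / (4 * c) - y * r := by
    have := mul_le_mul_of_nonneg_right hy hr.le
    have e : -(r ^ 2) / (4 * c) = -(r / (4 * c) * r) := by ring
    rw [e]
    linarith
  set S := {x ∈ Icc 0 D | h x ≤ -(r ^ 2) / (4 * c) - y * r} with hS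
  have h0S : (0 : ℝ) ∈ S := ⟨⟨le_rfl, hD.le⟩, h0.trans_le hFr⟩
  have hbdd : BddAbove S := ⟨D, fun x hx => hx.1.2⟩
  set b := sSup S
  have hb0 : 0 ≤ b := le_csSup hbdd h0S
  have hbD : b ≤ D := csSup_le ⟨0, h0S⟩ fun x hx => hx.1.2
  have hlow := antitoneOn_sub_of_lt hc0 hD hcont hbD hu hv hsub hsup (fun x hx => by
    obtain ⟨z, hz, hxz⟩ := exists_lt_of_lt_csSup ⟨0, h0S⟩ hx.2
    exact (hmono ⟨hx.1.le, hx.2.le.trans hbD⟩ hz.1 hxz).trans_le hz.2)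
  have hhigh := antitoneOn_sub_of_gt hb0 hmono hu hv hsub hsup (fun x hx => by
    by_contra! hle
    exact hx.1.not_ge (le_csSup hbdd ⟨⟨hb0.trans hx.1.le, hx.2⟩, hle⟩))
  have hleft : ∀ x ∈ Icc 0 b, u x ≤ v x := fun x hx => by
    have := hlow ⟨le_rfl, hb0⟩ hx hx.1
    simp only [hu0, hv0] at this
    linarith
  intro x hx
  rcases le_total x b with hxb | hbx
  · exact hleft x ⟨hx.1, hxb⟩
  · have h1 := hhigh ⟨le_rfl, hbD⟩ ⟨hbx, hx.2⟩ hbx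
    have h2 := hleft b ⟨hb0, le_rfl⟩
    simp only at h1
    linarith
end
end

section
/- Suppose −y ≥ r/(4c). Then the explicitly defined function g is a viscosity solution of the Bellman equation max{ −f′(x)²/(4c) − y f′(x) − h(x), f′(x) − r } = 0 on [0,D]: g(0) = 0, g is a viscosity subsolution on (0,D), and g is a viscosity supersolution on (0,D]. -/
open MeasureTheory Set

noncomputable section

/-- The explicit candidate value function `g`, built from the free-boundary point `β₀`:
`g(x) = ∫₀ˣ 2c(−y − √(y² − h(u)/c)) du` on `[0,β₀]`, affine with slope `r` beyond `β₀`. -/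
def gfun (c y r β₀ : ℝ) (h : ℝ → ℝ) (x : ℝ) : ℝ :=
  if x ≤ β₀ then ∫ u in Ioc (0:ℝ) x, 2 * c * (-y - Real.sqrt (y ^ 2 - h u / c))
  else (∫ u in Ioc (0:ℝ) β₀, 2 * c * (-y - Real.sqrt (y ^ 2 - h u / c))) + r * (x - β₀)

/-- If `ψ x` is minimal among values of `ψ` to the left of `x`, the left derivative is
nonpositive. -/
theorem HasDerivWithinAt.nonpos_of_le_left {ψ : ℝ → ℝ} {d a x : ℝ} (hax : a < x)
    (hψ : HasDerivWithinAt ψ d (Ioo a x) x) (hle : ∀ z ∈ Ioo a x, ψ x ≤ ψ z) : d ≤ 0 := by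
  rw [hasDerivWithinAt_iff_tendsto_slope' (by simp)] at hψ
  have : (nhdsWithin x (Ioo a x)).NeBot := right_nhdsWithin_Ioo_neBot hax
  refine le_of_tendsto hψ ?_
  filter_upwards [self_mem_nhdsWithin] with z hz
  rw [slope_def_field]
  exact div_nonpos_of_nonneg_of_nonpos (by linarith [hle z hz]) (by linarith [hz.2])

/-- If `ψ x` is maximal among values of `ψ` to the right of `x`, the right derivative is
nonpositive. -/
theorem HasDerivWithinAt.nonpos_of_le_right {ψ : ℝ → ℝ} {d b x : ℝ} (hxb : x < b)
    (hψ : HasDerivWithinAt ψ d (Ioo x b) x) (hle : ∀ z ∈ Ioo x b, ψ z ≤ ψ x) : d ≤ 0 := by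
  rw [hasDerivWithinAt_iff_tendsto_slope' (by simp)] at hψ
  have : (nhdsWithin x (Ioo x b)).NeBot := left_nhdsWithin_Ioo_neBot hxb
  refine le_of_tendsto hψ ?_
  filter_upwards [self_mem_nhdsWithin] with z hz
  rw [slope_def_field]
  exact div_nonpos_of_nonpos_of_nonneg (by linarith [hle z hz]) (by linarith [hz.1])

/-- The slope `2c(−y − √(y² − k/c))`: the smaller root of `q²/(4c) + y q + k = 0`. -/
def smallRoot (c y k : ℝ) : ℝ := 2 * c * (-y - Real.sqrt (y ^ 2 - k / c))

theorem continuous_smallRoot (c y : ℝ) : Continuous (smallRoot c y) := by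
  unfold smallRoot
  fun_prop

section Root

variable {c y r k : ℝ}

theorem sq_add_div_le_discrim (hc : 0 < c) (hk : k ≤ -(r ^ 2 / (4 * c)) - r * y) :
    (y + r / (2 * c)) ^ 2 ≤ y ^ 2 - k / c := by
  have h1 : k / c ≤ (-(r ^ 2 / (4 * c)) - r * y) / c := by gcongr
  have h2 : y ^ 2 - (-(r ^ 2 / (4 * c)) - r * y) / c = (y + r / (2 * c)) ^ 2 := by
    field_simp
    ring
  linarith

theorem smallRoot_isRoot (hc : 0 < c) (hk : k ≤ -(r ^ 2 / (4 * c)) - r * y) :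
    -(smallRoot c y k ^ 2) / (4 * c) - y * smallRoot c y k - k = 0 := by
  have hs := Real.sq_sqrt ((sq_nonneg _).trans (sq_add_div_le_discrim hc hk))
  unfold smallRoot
  set s := Real.sqrt (y ^ 2 - k / c)
  have hk' : k = c * (y ^ 2 - s ^ 2) := by
    rw [hs]
    field_simp
    ring
  rw [hk']
  field_simp
  ring

theorem smallRoot_le (hc : 0 < c) (hk : k ≤ -(r ^ 2 / (4 * c)) - r * y) :
    smallRoot c y k ≤ r := by
  have hs : -(y + r / (2 * c)) ≤ Real.sqrt (y ^ 2 - k / c) :=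
    (neg_le_abs _).trans (Real.abs_le_sqrt (sq_add_div_le_discrim hc hk))
  unfold smallRoot
  calc 2 * c * (-y - Real.sqrt (y ^ 2 - k / c)) ≤ 2 * c * (r / (2 * c)) := by
        gcongr
        linarith
    _ = r := by field_simp

/-- The concave quadratic `−p²/(4c) − y p − k` is nonnegative between its smaller root and `r`. -/
theorem quadratic_nonneg_of_mem_Icc {p : ℝ} (hc : 0 < c)
    (hk : k ≤ -(r ^ 2 / (4 * c)) - r * y) (hp : smallRoot c y k ≤ p) (hpr : p < r) :
    0 ≤ -(p ^ 2) / (4 * c) - y * p - k := by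
  have hroot := smallRoot_isRoot hc hk
  set q := smallRoot c y k
  have key : (r - q) * (-(p ^ 2) / (4 * c) - y * p - k) =
      (p - q) * (-(r ^ 2 / (4 * c)) - r * y - k) +
        (r - p) * (-(q ^ 2) / (4 * c) - y * q - k) +
        (r - q) * (p - q) * (r - p) / (4 * c) := by
    field_simp
    ring
  have hpq : 0 ≤ p - q := by linarith
  have hrp : 0 ≤ r - p := by linarith
  have hrq : 0 < r - q := by linarith
  have hkr : 0 ≤ -(r ^ 2 / (4 * c)) - r * y - k := by linarith
  refine nonneg_of_mul_nonneg_right ?_ hrq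
  rw [key, hroot]
  positivity

end Root

section Derivatives

variable {c y r β x : ℝ} {h : ℝ → ℝ}

theorem exists_continuous_eqOn_smallRoot (hβ : 0 ≤ β) (hcont : ContinuousOn h (Icc 0 β)) :
    ∃ Q : ℝ → ℝ, Continuous Q ∧ EqOn Q (fun u => smallRoot c y (h u)) (Icc 0 β) := by
  have hq : ContinuousOn (fun u => smallRoot c y (h u)) (Icc 0 β) :=
    (continuous_smallRoot c y).comp_continuousOn hcont
  exact ⟨IccExtend hβ ((Icc 0 β).domRestrict fun u => smallRoot c y (h u)),
    hq.domRestrict.Icc_extend', fun u hu => by rw [IccExtend_of_mem hβ _ hu]; rfl⟩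

theorem gfun_eq_integral {Q : ℝ → ℝ} (hQ : EqOn Q (fun u => smallRoot c y (h u)) (Icc 0 β))
    (hx : x ∈ Icc 0 β) : gfun c y r β h x = ∫ u in (0 : ℝ)..x, Q u := by
  rw [gfun, if_pos hx.2, intervalIntegral.integral_of_le hx.1]
  exact setIntegral_congr_fun measurableSet_Ioc
    fun u hu => (hQ ⟨hu.1.le, hu.2.trans hx.2⟩).symm

theorem gfun_eq_affine (hx : β ≤ x) :
    gfun c y r β h x = gfun c y r β h β + r * (x - β) := by
  rcases hx.eq_or_lt with rfl | hx
  · simp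
  · simp [gfun, not_le.mpr hx]

theorem gfun_hasDerivWithinAt_Icc (hβ : 0 ≤ β) (hcont : ContinuousOn h (Icc 0 β))
    (hx : x ∈ Icc 0 β) :
    HasDerivWithinAt (gfun c y r β h) (smallRoot c y (h x)) (Icc 0 β) x := by
  obtain ⟨Q, hQc, hQ⟩ := exists_continuous_eqOn_smallRoot (c := c) (y := y) hβ hcont
  have hd := (hQc.integral_hasStrictDerivAt 0 x).hasDerivAt.hasDerivWithinAt (s := Icc 0 β)
  rw [hQ hx] at hd
  exact hd.congr (fun z hz => gfun_eq_integral hQ hz) (gfun_eq_integral hQ hx)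

theorem gfun_hasDerivWithinAt_Ici (hx : β ≤ x) :
    HasDerivWithinAt (gfun c y r β h) r (Ici β) x := by
  have hd : HasDerivWithinAt (fun z => gfun c y r β h β + r * (z - β)) (r * 1) (Ici β) x :=
    ((((hasDerivAt_id x).sub_const β).const_mul r).const_add _).hasDerivWithinAt
  rw [mul_one] at hd
  exact hd.congr (fun z hz => gfun_eq_affine hz) (gfun_eq_affine hx)

theorem continuousOn_gfun {D : ℝ} (hβ : 0 ≤ β) (hcont : ContinuousOn h (Icc 0 β)) :
    ContinuousOn (gfun c y r β h) (Icc 0 D) := by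
  have h1 : ContinuousOn (gfun c y r β h) (Icc 0 β) :=
    fun z hz => (gfun_hasDerivWithinAt_Icc hβ hcont hz).continuousWithinAt
  have h2 : ContinuousOn (gfun c y r β h) (Ici β) :=
    fun z hz => (gfun_hasDerivWithinAt_Ici hz).continuousWithinAt
  refine (h1.union_of_isClosed h2 isClosed_Icc isClosed_Ici).mono fun z hz => ?_
  rcases le_total z β with hzβ | hzβ
  · exact Or.inl ⟨hz.1, hzβ⟩
  · exact Or.inr hzβ

end Derivatives

/-- if `−y ≥ r/(4c)`, the explicit function `g` is a viscosity solution of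
the Bellman equation on `[0,D]`: `g(0) = 0`, `g` is a viscosity subsolution on `(0,D)`
and a viscosity supersolution on `(0,D]`. -/
theorem stmt5 (c1 c2 y r D : ℝ) (hc1 : 0 < c1) (hc2 : 0 < c2) (hr : 0 < r) (hD : 0 < D)
    (h : ℝ → ℝ) (hcont : ContinuousOn h (Icc 0 D)) (hmono : StrictMonoOn h (Icc 0 D))
    (hnn : ∀ u ∈ Icc (0:ℝ) D, 0 ≤ h u) (h0 : h 0 = 0)
    (c : ℝ) (hc : c = (c1⁻¹ + c2⁻¹)⁻¹)
    (hy : r / (4 * c) ≤ -y)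
    (β₀ : ℝ) (hβmem : β₀ ∈ Icc (0:ℝ) D)
    (hβ1 : -(r ^ 2 / (4 * c)) - r * y ≤ h D → h β₀ = -(r ^ 2 / (4 * c)) - r * y)
    (hβ2 : h D < -(r ^ 2 / (4 * c)) - r * y → β₀ = D) :
    ContinuousOn (gfun c y r β₀ h) (Icc (0:ℝ) D)
      ∧ gfun c y r β₀ h 0 = 0
      ∧ IsViscositySubsol c y r D h (gfun c y r β₀ h) (Ioo 0 D)
      ∧ IsViscositySupersol c y r D h (gfun c y r β₀ h) (Ioc 0 D) := by
  have hc0 : 0 < c := by rw [hc]; positivity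
  set g := gfun c y r β₀ h
  set K := -(r ^ 2 / (4 * c)) - r * y with hK
  have hβ0 : 0 ≤ β₀ := hβmem.1
  have hcontβ : ContinuousOn h (Icc 0 β₀) := hcont.mono (Icc_subset_Icc_right hβmem.2)
  have hβle : h β₀ ≤ K := by
    rcases le_or_gt K (h D) with hKD | hKD
    · exact (hβ1 hKD).le
    · rw [hβ2 hKD]
      exact hKD.le
  have hle : ∀ x ∈ Icc 0 β₀, h x ≤ K := fun x hx =>
    (hmono.monotoneOn ⟨hx.1, hx.2.trans hβmem.2⟩ hβmem hx.2).trans hβle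
  have hge : ∀ x ∈ Ioo 0 D, β₀ ≤ x → K ≤ h x := fun x hx hβx => by
    rcases le_or_gt K (h D) with hKD | hKD
    · rw [← hβ1 hKD]
      exact hmono.monotoneOn hβmem ⟨hx.1.le, hx.2.le⟩ hβx
    · linarith [hβ2 hKD, hx.2]
  have hleft : ∀ x, 0 < x → x ≤ β₀ →
      HasDerivWithinAt g (smallRoot c y (h x)) (Ioo 0 x) x := fun x hx hxβ =>
    (gfun_hasDerivWithinAt_Icc hβ0 hcontβ ⟨hx.le, hxβ⟩).mono
      (Ioo_subset_Icc_self.trans (Icc_subset_Icc_right hxβ))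
  have hleft' : ∀ x, β₀ < x → HasDerivWithinAt g r (Ioo β₀ x) x := fun x hx =>
    (gfun_hasDerivWithinAt_Ici hx.le).mono fun z hz => hz.1.le
  have hφ : ∀ (φ : ℝ → ℝ), ContDiffOn ℝ 1 φ (Icc 0 D) → ∀ x ∈ Ioc 0 D, ∀ s ⊆ Icc 0 D,
      HasDerivWithinAt φ (derivWithin φ (Icc 0 D) x) s x := fun φ hφ x hx s hs =>
    ((hφ.differentiableOn one_ne_zero x ⟨hx.1.le, hx.2⟩).hasDerivWithinAt).mono hs
  refine ⟨continuousOn_gfun hβ0 hcontβ, by simp [g, gfun, hβ0], ?_, ?_⟩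
  · intro x hx φ hφd hmax
    have hxD : x ∈ Ioc 0 D := ⟨hx.1, hx.2.le⟩
    set p := derivWithin φ (Icc 0 D) x
    have hmin : ∀ z ∈ Ioo 0 D, φ x - g x ≤ φ z - g z := fun z hz => by linarith [hmax z hz]
    rcases lt_or_ge x β₀ with hxβ | hxβ
    · have hk := hle x ⟨hx.1.le, hxβ.le⟩
      have hpl : p - smallRoot c y (h x) ≤ 0 :=
        ((hφ φ hφd x hxD _ (fun z hz => ⟨hz.1.le, hz.2.le.trans hx.2.le⟩)).sub
          (hleft x hx.1 hxβ.le)).nonpos_of_le_left hx.1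
          fun z hz => hmin z ⟨hz.1, hz.2.trans hx.2⟩
      have hpr : smallRoot c y (h x) - p ≤ 0 :=
        (((gfun_hasDerivWithinAt_Icc hβ0 hcontβ ⟨hx.1.le, hxβ.le⟩).mono
          fun z hz => ⟨(hx.1.trans hz.1).le, hz.2.le⟩).sub
          (hφ φ hφd x hxD _ (fun z hz => ⟨(hx.1.trans hz.1).le,
            hz.2.le.trans hβmem.2⟩))).nonpos_of_le_right hxβ
          fun z hz => hmax z ⟨hx.1.trans hz.1, hz.2.trans_le hβmem.2⟩
      have hp : p = smallRoot c y (h x) := by linarith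
      rw [hp]
      exact max_le (smallRoot_isRoot hc0 hk).le (sub_nonpos.mpr (smallRoot_le hc0 hk))
    · have hpr : r - p ≤ 0 :=
        (((gfun_hasDerivWithinAt_Ici hxβ).mono fun z hz => hxβ.trans hz.1.le).sub
          (hφ φ hφd x hxD _ (fun z hz => ⟨(hx.1.trans hz.1).le,
            hz.2.le⟩))).nonpos_of_le_right hx.2
          fun z hz => hmax z ⟨hx.1.trans hz.1, hz.2⟩
      have hpl : p - r ≤ 0 := by
        rcases hxβ.eq_or_lt with heq | hxβ
        · have hpl : p - smallRoot c y (h x) ≤ 0 :=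
            ((hφ φ hφd x hxD _ (fun z hz => ⟨hz.1.le, hz.2.le.trans hx.2.le⟩)).sub
              (hleft x hx.1 heq.ge)).nonpos_of_le_left hx.1
              fun z hz => hmin z ⟨hz.1, hz.2.trans hx.2⟩
          linarith [smallRoot_le hc0 (hle x ⟨hx.1.le, heq.ge⟩)]
        · exact ((hφ φ hφd x hxD _ (fun z hz => ⟨hβ0.trans hz.1.le, hz.2.le.trans hx.2.le⟩)).sub
            (hleft' x hxβ)).nonpos_of_le_left hxβ
            fun z hz => hmin z ⟨hβ0.trans_lt hz.1, hz.2.trans hx.2⟩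
      have hp : p = r := by linarith
      rw [hp]
      refine max_le ?_ (sub_self r).le
      have := hge x hx hxβ
      rw [neg_div]
      linarith
  · intro x hx φ hφd hmin
    set p := derivWithin φ (Icc 0 D) x
    rcases le_or_gt x β₀ with hxβ | hxβ
    · have hpl : smallRoot c y (h x) - p ≤ 0 :=
        ((hleft x hx.1 hxβ).sub (hφ φ hφd x hx _
          (fun z hz => ⟨hz.1.le, hz.2.le.trans hx.2⟩))).nonpos_of_le_left hx.1
          fun z hz => hmin z ⟨hz.1, hz.2.le.trans hx.2⟩
      rcases lt_or_ge p r with hpr | hpr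
      · exact le_max_of_le_left
          (quadratic_nonneg_of_mem_Icc hc0 (hle x ⟨hx.1.le, hxβ⟩) (by linarith) hpr)
      · exact le_max_of_le_right (sub_nonneg.mpr hpr)
    · have hpl : r - p ≤ 0 :=
        ((hleft' x hxβ).sub (hφ φ hφd x hx _
          (fun z hz => ⟨hβ0.trans hz.1.le, hz.2.le.trans hx.2⟩))).nonpos_of_le_left hxβ
          fun z hz => hmin z ⟨hβ0.trans_lt hz.1, hz.2.le.trans hx.2⟩
      exact le_max_of_le_right (by linarith)
end
end

section
/- (Smooth approximation of g near the free boundary.) Suppose −y ≥ r/(4c), β₀ < D, and r/(2c) + y > 0 (equivalently, the left-derivative of g at β₀ is strictly less than r). Then there exists a family (g_δ)_{δ>0} of continuously differentiable real-valued functions on [0,D] such that: (c1) each g_δ ∈ C¹([0,D]); (c2) g_δ′(β₀) = r; (c3) for every x ∈ [0,β₀], −g_δ′(x)²/(4c) − y g_δ′(x) − h(x) ≥ 0; and (c4) sup_{x∈[0,D]} |g_δ(x) − g(x)| → 0 as δ → 0. -/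
open MeasureTheory Set

noncomputable section

lemma quadratic_nonneg_of_convex_comb {c y k p q a : ℝ} (hc : 0 < c) (ha0 : 0 ≤ a) (ha1 : a ≤ 1)
    (hp : 0 ≤ -p ^ 2 / (4 * c) - y * p - k) (hq : 0 ≤ -q ^ 2 / (4 * c) - y * q - k) :
    0 ≤ -(a * p + (1 - a) * q) ^ 2 / (4 * c) - y * (a * p + (1 - a) * q) - k := by
  have key : -(a * p + (1 - a) * q) ^ 2 / (4 * c) - y * (a * p + (1 - a) * q) - k
      = a * (-p ^ 2 / (4 * c) - y * p - k) + (1 - a) * (-q ^ 2 / (4 * c) - y * q - k)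
        + a * (1 - a) * (p - q) ^ 2 / (4 * c) := by
    field_simp
    ring
  have ha : 0 ≤ 1 - a := sub_nonneg.2 ha1
  rw [key]
  positivity

lemma quadratic_lower_root {c y k : ℝ} (hc : 0 < c) (hk : 0 ≤ y ^ 2 - k / c) :
    -(2 * c * (-y - √(y ^ 2 - k / c))) ^ 2 / (4 * c)
      - y * (2 * c * (-y - √(y ^ 2 - k / c))) - k = 0 := by
  have hs := Real.sq_sqrt hk
  set w := √(y ^ 2 - k / c)
  have hk' : k = c * (y ^ 2 - w ^ 2) := by
    rw [hs]
    field_simp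
    ring
  rw [hk']
  field_simp
  ring

lemma discriminant_nonneg {c y k p : ℝ} (hc : 0 < c) (hp : 0 ≤ -p ^ 2 / (4 * c) - y * p - k) :
    0 ≤ y ^ 2 - k / c := by
  have key : y ^ 2 - k / c = (p / (2 * c) + y) ^ 2 + (-p ^ 2 / (4 * c) - y * p - k) / c := by
    field_simp
    ring
  rw [key]
  positivity

/-- A continuous cutoff equal to `1` on `[b, ∞)` and decaying exponentially, at scale `δ`,
to the left of `b`. -/
def expCutoff (b δ x : ℝ) : ℝ := Real.exp (min (x - b) 0 / δ)

lemma continuous_expCutoff (b δ : ℝ) : Continuous (expCutoff b δ) := by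
  unfold expCutoff
  fun_prop

lemma expCutoff_le_one {δ : ℝ} (hδ : 0 < δ) (b x : ℝ) : expCutoff b δ x ≤ 1 :=
  Real.exp_le_one_iff.2 (div_nonpos_of_nonpos_of_nonneg (min_le_right _ _) hδ.le)

lemma expCutoff_of_le {b x : ℝ} (hx : b ≤ x) (δ : ℝ) : expCutoff b δ x = 1 := by
  simp [expCutoff, min_eq_right (sub_nonneg.2 hx)]

lemma integral_expCutoff_le {b δ x : ℝ} (hδ : 0 < δ) (hx : x ≤ b) (hx0 : 0 ≤ x) :
    ∫ t in (0 : ℝ)..x, expCutoff b δ t ≤ δ := by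
  have hderiv : ∀ t ∈ uIcc 0 x,
      HasDerivAt (fun t => δ * Real.exp ((t - b) / δ)) (expCutoff b δ t) t := by
    intro t ht
    rw [uIcc_of_le hx0] at ht
    have h1 : HasDerivAt (fun t => δ * Real.exp ((t - b) / δ))
        (δ * (Real.exp ((t - b) / δ) * (1 / δ))) t :=
      ((((hasDerivAt_id t).sub_const b).div_const δ).exp).const_mul δ
    convert h1 using 1
    rw [expCutoff, min_eq_left (by linarith [ht.2])]
    field_simp
  rw [intervalIntegral.integral_eq_sub_of_hasDerivAt hderiv
    ((continuous_expCutoff b δ).intervalIntegrable _ _)]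
  have h1 : Real.exp ((x - b) / δ) ≤ 1 :=
    Real.exp_le_one_iff.2 (div_nonpos_of_nonpos_of_nonneg (by linarith) hδ.le)
  have h2 : 0 ≤ δ * Real.exp ((0 - b) / δ) := by positivity
  nlinarith

/-- Replacing a continuous `s` by its cutoff interpolation with the constant `r` changes the
primitive on `[0, b]` by at most `M * δ`. -/
lemma abs_integral_cutoff_sub_le {b δ r M x : ℝ} {s : ℝ → ℝ} (hs : Continuous s) (hδ : 0 < δ)
    (hM0 : 0 ≤ M) (hx0 : 0 ≤ x) (hx : x ≤ b) (hM : ∀ t ∈ Icc 0 x, |r - s t| ≤ M) :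
    |(∫ t in (0 : ℝ)..x, (expCutoff b δ t * r + (1 - expCutoff b δ t) * s t))
      - ∫ t in (0 : ℝ)..x, s t| ≤ M * δ := by
  have hφ := continuous_expCutoff b δ
  rw [← intervalIntegral.integral_sub
    (Continuous.intervalIntegrable (by fun_prop) _ _) (hs.intervalIntegrable _ _)]
  have hbound : ∀ t ∈ Ioc 0 x,
      ‖expCutoff b δ t * r + (1 - expCutoff b δ t) * s t - s t‖ ≤ M * expCutoff b δ t := by
    intro t ht
    have hpos : 0 ≤ expCutoff b δ t := (Real.exp_pos _).le
    have heq : expCutoff b δ t * r + (1 - expCutoff b δ t) * s t - s t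
        = (r - s t) * expCutoff b δ t := by ring
    rw [heq, Real.norm_eq_abs, abs_mul, abs_of_nonneg hpos]
    exact mul_le_mul_of_nonneg_right (hM t (Ioc_subset_Icc_self ht)) hpos
  have hle := intervalIntegral.norm_integral_le_of_norm_le hx0
    (Filter.Eventually.of_forall hbound)
    (Continuous.intervalIntegrable (μ := volume) (by fun_prop) 0 x)
  rw [intervalIntegral.integral_const_mul] at hle
  exact hle.trans (mul_le_mul_of_nonneg_left (integral_expCutoff_le hδ hx hx0) hM0)

/-- smooth approximation of `g` near the free boundary: if `−y ≥ r/(4c)`,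
`β₀ < D` and `r/(2c) + y > 0`, there is a family `(g_δ)` of `C¹` functions on `[0,D]`
with `g_δ′(β₀) = r`, satisfying `−g_δ′(x)²/(4c) − y g_δ′(x) − h(x) ≥ 0` on `[0,β₀]`,
and converging to `g` uniformly on `[0,D]` as `δ → 0⁺`. -/
theorem stmt8 (c1 c2 y r D : ℝ) (hc1 : 0 < c1) (hc2 : 0 < c2) (hr : 0 < r) (hD : 0 < D)
    (h : ℝ → ℝ) (hcont : ContinuousOn h (Icc 0 D)) (hmono : StrictMonoOn h (Icc 0 D))
    (hnn : ∀ u ∈ Icc (0:ℝ) D, 0 ≤ h u) (h0 : h 0 = 0)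
    (c : ℝ) (hc : c = (c1⁻¹ + c2⁻¹)⁻¹)
    (hy : r / (4 * c) ≤ -y)
    (β₀ : ℝ) (hβmem : β₀ ∈ Icc (0:ℝ) D)
    (hβ1 : -(r ^ 2 / (4 * c)) - r * y ≤ h D → h β₀ = -(r ^ 2 / (4 * c)) - r * y)
    (hβ2 : h D < -(r ^ 2 / (4 * c)) - r * y → β₀ = D)
    (hβD : β₀ < D) (hslope : 0 < r / (2 * c) + y) :
    ∃ G : ℝ → (ℝ → ℝ),
      (∀ δ : ℝ, 0 < δ →
        ContDiffOn ℝ 1 (G δ) (Icc 0 D)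
        ∧ derivWithin (G δ) (Icc 0 D) β₀ = r
        ∧ ∀ x ∈ Icc (0:ℝ) β₀,
            0 ≤ -(derivWithin (G δ) (Icc 0 D) x) ^ 2 / (4 * c)
                  - y * derivWithin (G δ) (Icc 0 D) x - h x)
      ∧ (∀ ε : ℝ, 0 < ε → ∃ δ₀ : ℝ, 0 < δ₀ ∧ ∀ δ : ℝ, 0 < δ → δ < δ₀ →
          ∀ x ∈ Icc (0:ℝ) D, |G δ x - gfun c y r β₀ h x| ≤ ε) := by
  have hcpos : 0 < c := by rw [hc]; positivity
  have hβ : h β₀ = -(r ^ 2 / (4 * c)) - r * y :=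
    hβ1 (not_lt.1 fun hlt => hβD.ne (hβ2 hlt))
  obtain ⟨s, hs, hsh⟩ : ∃ s : ℝ → ℝ, Continuous s ∧
      ∀ x ∈ Icc 0 D, s x = 2 * c * (-y - √(y ^ 2 - h x / c)) := by
    have hk : Continuous (IccExtend hD.le ((Icc 0 D).domRestrict h)) :=
      hcont.domRestrict.Icc_extend'
    refine ⟨fun x => 2 * c * (-y - √(y ^ 2 - IccExtend hD.le ((Icc 0 D).domRestrict h) x / c)),
      by fun_prop, fun x hx => ?_⟩
    simp only [IccExtend_of_mem hD.le _ hx, domRestrict_apply]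
  obtain ⟨M, hM⟩ := (isCompact_Icc (a := (0 : ℝ)) (b := D)).exists_bound_of_continuousOn
    (f := fun t => r - s t) (by fun_prop)
  have hM0 : 0 ≤ M := (norm_nonneg _).trans (hM 0 ⟨le_rfl, hD.le⟩)
  have hg : ∀ x ∈ Icc 0 β₀, ∫ u in Ioc (0 : ℝ) x, 2 * c * (-y - √(y ^ 2 - h u / c))
      = ∫ t in (0 : ℝ)..x, s t := by
    intro x hx
    rw [intervalIntegral.integral_of_le hx.1]
    exact setIntegral_congr_fun measurableSet_Ioc fun t ht =>
      (hsh t ⟨ht.1.le, (ht.2.trans hx.2).trans hβD.le⟩).symm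
  let f : ℝ → ℝ → ℝ := fun δ t => expCutoff β₀ δ t * r + (1 - expCutoff β₀ δ t) * s t
  have hf : ∀ δ, Continuous (f δ) := fun δ => by
    have hφ := continuous_expCutoff β₀ δ
    fun_prop
  have hG : ∀ δ x, HasDerivAt (fun x => ∫ t in (0 : ℝ)..x, f δ t) (f δ x) x := fun δ x =>
    (hf δ).integral_hasStrictDerivAt 0 x |>.hasDerivAt
  have hGw : ∀ δ, ∀ x ∈ Icc 0 D,
      derivWithin (fun x => ∫ t in (0 : ℝ)..x, f δ t) (Icc 0 D) x = f δ x := fun δ x hx =>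
    (hG δ x).hasDerivWithinAt.derivWithin (uniqueDiffOn_Icc hD x hx)
  refine ⟨fun δ x => ∫ t in (0 : ℝ)..x, f δ t, fun δ hδ => ⟨?_, ?_, ?_⟩, fun ε hε => ?_⟩
  · refine ContDiff.contDiffOn (contDiff_one_iff_deriv.2
      ⟨fun x => (hG δ x).differentiableAt, ?_⟩)
    rw [funext fun x => (hG δ x).deriv]
    exact hf δ
  · rw [hGw δ β₀ hβmem]
    simp [f, expCutoff_of_le le_rfl]
  · intro x hx
    have hxD : x ∈ Icc 0 D := ⟨hx.1, hx.2.trans hβD.le⟩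
    have hr' : 0 ≤ -r ^ 2 / (4 * c) - y * r - h x := by
      have := hmono.monotoneOn hxD hβmem hx.2
      rw [hβ] at this
      rw [neg_div]
      linarith
    rw [hGw δ x hxD]
    refine quadratic_nonneg_of_convex_comb hcpos (Real.exp_pos _).le
      (expCutoff_le_one hδ _ _) hr' ?_
    rw [hsh x hxD]
    exact (quadratic_lower_root hcpos (discriminant_nonneg hcpos hr')).ge
  · refine ⟨ε / (M + 1), by positivity, fun δ hδ hδε x hx => ?_⟩
    have hMδ : M * δ ≤ ε := by
      rw [lt_div_iff₀ (by positivity)] at hδε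
      linarith
    refine le_trans ?_ hMδ
    have hclose : ∀ x ∈ Icc 0 β₀,
        |(∫ t in (0 : ℝ)..x, f δ t) - ∫ t in (0 : ℝ)..x, s t| ≤ M * δ := fun x hx =>
      abs_integral_cutoff_sub_le hs hδ hM0 hx.1 hx.2 fun t ht =>
        hM t ⟨ht.1, (ht.2.trans hx.2).trans hβD.le⟩
    unfold gfun
    split_ifs with hxβ
    · rw [hg x ⟨hx.1, hxβ⟩]
      exact hclose x ⟨hx.1, hxβ⟩
    · have hβx : β₀ ≤ x := (not_le.1 hxβ).le
      have htail : ∫ t in β₀..x, f δ t = r * (x - β₀) := by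
        have hcongr : EqOn (f δ) (fun _ => r) (uIcc β₀ x) := fun t ht => by
          rw [uIcc_of_le hβx] at ht
          simp [f, expCutoff_of_le ht.1]
        rw [intervalIntegral.integral_congr hcongr, intervalIntegral.integral_const,
          smul_eq_mul, mul_comm]
      simp only
      rw [hg β₀ ⟨hβmem.1, le_rfl⟩, ← htail,
        ← intervalIntegral.integral_add_adjacent_intervals
          ((hf δ).intervalIntegrable 0 β₀) ((hf δ).intervalIntegrable β₀ x),
        add_sub_add_right_eq_sub]
      exact hclose β₀ ⟨hβmem.1, le_rfl⟩
end
end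

section
/- (Well-posedness of the maximizer's optimal-response ODE.) Suppose y < 0, c > 0, D > 0, and h : ℝ → [0,∞) is Lipschitz and nondecreasing with h(u) = 0 for u ≤ 0 and h constant on [D,∞). Fix x ∈ [0,D] and δ ≥ 0 such that x + yδ ∈ [0,D] and y² − h(x+yδ)/c > 0. Set τ̃ = δ + ∫₀^{x+yδ} (y² − h(ξ)/c)^{−1/2} dξ. Then there exists a unique continuous function ω : [0,τ̃] → ℝ such that ω ≡ 0 on [0,δ], ω is continuously differentiable on [δ,τ̃], and ω̇(t) = −y − √( y² − h( min(x + y t + ω(t), x + yδ) )/c ) for all t ∈ [δ,τ̃]. -/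
open MeasureTheory Set

/-- The square root is `1 / √m`-Lipschitz on `[m, ∞)`. -/
lemma abs_sqrt_sub_sqrt_le_div {m a b : ℝ} (hm : 0 < m) (ha : m ≤ a) (hb : m ≤ b) :
    |Real.sqrt a - Real.sqrt b| ≤ |a - b| / Real.sqrt m := by
  have hsm : 0 < Real.sqrt m := Real.sqrt_pos.mpr hm
  have hab : a - b = (Real.sqrt a - Real.sqrt b) * (Real.sqrt a + Real.sqrt b) := by
    nlinarith [Real.mul_self_sqrt (hm.le.trans ha), Real.mul_self_sqrt (hm.le.trans hb)]
  rw [le_div_iff₀ hsm, hab, abs_mul]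
  refine mul_le_mul_of_nonneg_left ?_ (abs_nonneg _)
  exact ((Real.sqrt_le_sqrt ha).trans
    (le_add_of_nonneg_right (Real.sqrt_nonneg b))).trans (le_abs_self _)

/-- A bounded vector field, continuous in time and uniformly Lipschitz in space, has a solution
on every compact time interval. -/
lemma exists_solution_Icc_of_lipschitzWith_of_bounded {E : Type*} [NormedAddCommGroup E]
    [NormedSpace ℝ E] [CompleteSpace E] {v : ℝ → E → E} {K L : NNReal} {a b : ℝ} (hab : a ≤ b)
    (hlip : ∀ t, LipschitzWith K (v t)) (hcont : ∀ u, Continuous fun t => v t u)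
    (hbound : ∀ t u, ‖v t u‖ ≤ L) (u₀ : E) :
    ∃ α : ℝ → E, α a = u₀ ∧ ∀ t ∈ Icc a b, HasDerivWithinAt α (v t (α t)) (Icc a b) t := by
  have hpl : IsPicardLindelof v (⟨a, left_mem_Icc.mpr hab⟩ : Icc a b) u₀
      (L * Real.toNNReal (b - a)) 0 L K :=
    { lipschitzOnWith := fun t _ => (hlip t).lipschitzOnWith
      continuousOn := fun u _ => (hcont u).continuousOn
      norm_le := fun t _ u _ => hbound t u
      mul_max_le := by simp [hab] }
  exact hpl.exists_eq_forall_mem_Icc_hasDerivWithinAt₀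

/-- well-posedness of the maximizer's optimal-response ODE: with `y < 0`,
`c > 0`, `h : ℝ → [0,∞)` Lipschitz and nondecreasing, vanishing on `(−∞,0]` and constant
on `[D,∞)`, `x ∈ [0,D]`, `δ ≥ 0` with `x + yδ ∈ [0,D]` and `y² − h(x+yδ)/c > 0`, and
`τ̃ = δ + ∫₀^{x+yδ} (y² − h(ξ)/c)^{−1/2} dξ`, there is a unique continuous
`ω : [0,τ̃] → ℝ` vanishing on `[0,δ]` and solving, on `[δ,τ̃]`,
`ω̇(t) = −y − √(y² − h(min(x + yt + ω(t), x + yδ))/c)`. -/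
theorem stmt11 (c y D : ℝ) (hcpos : 0 < c) (hy : y < 0) (hD : 0 < D)
    (h : ℝ → ℝ) (hLip : ∃ K : NNReal, LipschitzWith K h) (hmono : Monotone h)
    (hnn : ∀ u : ℝ, 0 ≤ h u) (hzero : ∀ u : ℝ, u ≤ 0 → h u = 0)
    (hconst : ∀ u : ℝ, D ≤ u → h u = h D)
    (x δ : ℝ) (hx : x ∈ Icc (0:ℝ) D) (hδ : 0 ≤ δ) (hxδ : x + y * δ ∈ Icc (0:ℝ) D)
    (hroot : 0 < y ^ 2 - h (x + y * δ) / c)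
    (τ : ℝ) (hτ : τ = δ + ∫ ξ in Ioc (0:ℝ) (x + y * δ), (Real.sqrt (y ^ 2 - h ξ / c))⁻¹) :
    ∃ ω : ℝ → ℝ,
      (ContinuousOn ω (Icc 0 τ)
        ∧ (∀ t ∈ Icc (0:ℝ) δ, ω t = 0)
        ∧ (∀ t ∈ Icc δ τ, HasDerivWithinAt ω
            (-y - Real.sqrt (y ^ 2 - h (min (x + y * t + ω t) (x + y * δ)) / c))
            (Icc δ τ) t))
      ∧ ∀ ω' : ℝ → ℝ,
          (ContinuousOn ω' (Icc 0 τ)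
            ∧ (∀ t ∈ Icc (0:ℝ) δ, ω' t = 0)
            ∧ (∀ t ∈ Icc δ τ, HasDerivWithinAt ω'
                (-y - Real.sqrt (y ^ 2 - h (min (x + y * t + ω' t) (x + y * δ)) / c))
                (Icc δ τ) t)) →
          ∀ t ∈ Icc (0:ℝ) τ, ω' t = ω t := by
  obtain ⟨K, hK⟩ := hLip
  set p := x + y * δ with hp
  set m := y ^ 2 - h p / c with hm
  set v : ℝ → ℝ → ℝ := fun t u => -y - Real.sqrt (y ^ 2 - h (min (x + y * t + u) p) / c) with hv
  have hδτ : δ ≤ τ := by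
    rw [hτ]
    exact le_add_of_nonneg_right (integral_nonneg fun ξ => inv_nonneg.mpr (Real.sqrt_nonneg _))
  have hlower : ∀ w, m ≤ y ^ 2 - h (min w p) / c := fun w => by
    have := div_le_div_of_nonneg_right (hmono (min_le_right w p)) hcpos.le
    linarith
  have hlip : ∀ t, LipschitzWith (K / (c.toNNReal * (Real.sqrt m).toNNReal)) (v t) := by
    refine fun t => LipschitzWith.of_dist_le_mul fun u w => ?_
    have hh : |h (min (x + y * t + u) p) - h (min (x + y * t + w) p)| ≤ K * |u - w| := by
      refine (hK.dist_le_mul _ _).trans (mul_le_mul_of_nonneg_left ?_ K.coe_nonneg)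
      simpa [Real.dist_eq] using abs_min_sub_min_le_max (x + y * t + u) p (x + y * t + w) p
    have hs := abs_sqrt_sub_sqrt_le_div hroot (hlower (x + y * t + w)) (hlower (x + y * t + u))
    have hd : (y ^ 2 - h (min (x + y * t + w) p) / c) - (y ^ 2 - h (min (x + y * t + u) p) / c)
        = (h (min (x + y * t + u) p) - h (min (x + y * t + w) p)) / c := by ring
    rw [hd, abs_div, abs_of_pos hcpos] at hs
    have hv' : v t u - v t w = Real.sqrt (y ^ 2 - h (min (x + y * t + w) p) / c)
        - Real.sqrt (y ^ 2 - h (min (x + y * t + u) p) / c) := by simp only [hv]; ring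
    rw [Real.dist_eq, Real.dist_eq, hv', NNReal.coe_div, NNReal.coe_mul,
      Real.coe_toNNReal _ hcpos.le, Real.coe_toNNReal _ (Real.sqrt_nonneg m)]
    calc _ ≤ _ := hs
      _ ≤ K * |u - w| / c / Real.sqrt m := by gcongr
      _ = _ := by rw [div_div]; ring
  have hcont : ∀ u, Continuous fun t => v t u := fun u => by
    have := hK.continuous
    simp only [hv]
    fun_prop
  have hbound : ∀ t u, ‖v t u‖ ≤ (-y).toNNReal := fun t u => by
    rw [Real.coe_toNNReal _ (by linarith), Real.norm_eq_abs, abs_le]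
    have hle : Real.sqrt (y ^ 2 - h (min (x + y * t + u) p) / c) ≤ -y := by
      rw [Real.sqrt_le_left (by linarith)]
      have := div_nonneg (hnn (min (x + y * t + u) p)) hcpos.le
      linarith [neg_sq y]
    have := Real.sqrt_nonneg (y ^ 2 - h (min (x + y * t + u) p) / c)
    simp only [hv]
    constructor <;> linarith
  obtain ⟨α, hα₀, hα⟩ :=
    exists_solution_Icc_of_lipschitzWith_of_bounded hδτ hlip hcont hbound (0 : ℝ)
  have hαc : ContinuousOn α (Icc δ τ) := fun t ht => (hα t ht).continuousWithinAt
  have heq : ∀ t, δ ≤ t → α (max t δ) = α t := fun t ht => by rw [max_eq_left ht]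
  have hright : ∀ {f : ℝ → ℝ},
      (∀ t ∈ Icc δ τ, HasDerivWithinAt f (v t (f t)) (Icc δ τ) t) →
      ∀ t ∈ Ico δ τ, HasDerivWithinAt f (v t (f t)) (Ici t) t := fun hf t ht =>
    (hf t (Ico_subset_Icc_self ht)).mono_of_mem_nhdsWithin (Icc_mem_nhdsGE_of_mem ht)
  refine ⟨fun t => α (max t δ), ⟨?_, fun t ht => ?_, fun t ht => ?_⟩, ?_⟩
  · refine hαc.comp (by fun_prop) fun t ht => ⟨le_max_right _ _, max_le ht.2 hδτ⟩
  · simp only [max_eq_right ht.2, hα₀]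
  · have h₁ := (hα t ht).congr (f₁ := fun s => α (max s δ)) (fun s hs => heq s hs.1) (heq t ht.1)
    simpa only [hv, heq t ht.1] using h₁
  · rintro ω' ⟨-, hω₀, hω⟩ t ht
    rcases le_total t δ with htδ | hδt
    · simp only [max_eq_right htδ, hα₀, hω₀ t ⟨ht.1, htδ⟩]
    · simp only [heq t hδt]
      refine ODE_solution_unique hlip (fun s hs => (hω s hs).continuousWithinAt) (hright hω)
        hαc (hright hα) ?_ ⟨hδt, ht.2⟩
      rw [hω₀ δ (right_mem_Icc.mpr hδ), hα₀]
end

section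
/- (The optimal response to the β₀-barrier strategy achieves the value, with explicit termination time.) Suppose −y ≥ r/(4c) and h is in addition Lipschitz on [0,D]. Fix x ∈ [0,β₀] with y² − h(x)/c > 0, set τ̃ = ∫₀ˣ (y² − h(ξ)/c)^{−1/2} dξ, and let ω : [0,τ̃] → ℝ be a continuously differentiable function with ω(0) = 0 solving ω̇(t) = −y − √(y² − h(x + y t + ω(t))/c) on [0,τ̃]. Then: (i) φ(t) := x + y t + ω(t) is strictly decreasing on [0,τ̃], takes values in [0,x], and satisfies φ(0) = x and φ(τ̃) = 0 (so τ̃ is the termination time of the game); and (ii) with the path control p = ((c/c₁)·ω̇, −(c/c₂)·ω̇) and zero rejection, the cost equals the value: ∫₀^{τ̃} [ h(φ(t)) − c₁ p¹(t)² − c₂ p²(t)² ] dt = g(x). -/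
open MeasureTheory Set

noncomputable section

/-- Change of variables along a trajectory of `dφ/dt = -S(φ)` on `[0, T]`. -/
theorem integral_comp_mul_speed {S φ k : ℝ → ℝ} {T : ℝ} {J : Set ℝ} (hT : 0 ≤ T)
    (hS : ContinuousOn S J) (hk : ContinuousOn k J) (hφ : ContinuousOn φ (Icc 0 T))
    (hφJ : MapsTo φ (Icc 0 T) J) (hd : ∀ t ∈ Ioo 0 T, HasDerivAt φ (-S (φ t)) t) :
    ∫ t in (0:ℝ)..T, k (φ t) * S (φ t) = ∫ u in (φ T)..(φ 0), k u := by
  have key := intervalIntegral.integral_comp_mul_deriv'' (a := 0) (b := T) (f := φ)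
    (f' := fun t => -S (φ t)) (g := k) (by rwa [uIcc_of_le hT])
    (by
      rw [min_eq_left hT, max_eq_right hT]
      exact fun t ht => (hd t ht).hasDerivWithinAt)
    (by rw [uIcc_of_le hT]; exact (hS.comp hφ hφJ).neg)
    (by rw [uIcc_of_le hT]; exact hk.mono hφJ.image_subset)
  rw [intervalIntegral.integral_symm (φ 0) (φ T), ← key, ← intervalIntegral.integral_neg]
  exact intervalIntegral.integral_congr fun t _ => by simp

/-- A trajectory of `dφ/dt = -S(φ)` started at `x`, with `S` nonnegative everywhere and positive and
continuous on `[0, x]`, decreases strictly and reaches `0` exactly at time `∫₀ˣ S⁻¹`. -/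
theorem strictAntiOn_and_hitting_time {S φ : ℝ → ℝ} {x τ : ℝ} (hx : 0 ≤ x)
    (hS : ContinuousOn S (Icc 0 x)) (hS0 : ∀ u, 0 ≤ S u) (hSpos : ∀ u ∈ Icc 0 x, 0 < S u)
    (hτ : τ = ∫ u in (0:ℝ)..x, (S u)⁻¹) (hφ : ContinuousOn φ (Icc 0 τ)) (hφ0 : φ 0 = x)
    (hd : ∀ t ∈ Ioo 0 τ, HasDerivAt φ (-S (φ t)) t) :
    StrictAntiOn φ (Icc 0 τ) ∧ MapsTo φ (Icc 0 τ) (Icc 0 x) ∧ φ τ = 0 := by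
  have hτ0 : 0 ≤ τ := hτ ▸ intervalIntegral.integral_nonneg hx fun u _ => inv_nonneg.2 (hS0 u)
  have hinv : ContinuousOn (fun u => (S u)⁻¹) (Icc 0 x) := hS.inv₀ fun u hu => (hSpos u hu).ne'
  have hanti : AntitoneOn φ (Icc 0 τ) := by
    refine antitoneOn_of_deriv_nonpos (convex_Icc 0 τ) hφ ?_ ?_ <;> rw [interior_Icc]
    · exact fun t ht => (hd t ht).differentiableAt.differentiableWithinAt
    · intro t ht
      rw [(hd t ht).deriv]
      exact neg_nonpos.2 (hS0 _)
  have elapsed : ∀ s ∈ Icc 0 τ, 0 ≤ φ s → s = ∫ u in (φ s)..x, (S u)⁻¹ := by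
    intro s hs hφs
    have hmaps : MapsTo φ (Icc 0 s) (Icc 0 x) := fun t ht =>
      ⟨hφs.trans (hanti ⟨ht.1, ht.2.trans hs.2⟩ hs ht.2),
        hφ0 ▸ hanti (left_mem_Icc.2 hτ0) ⟨ht.1, ht.2.trans hs.2⟩ ht.1⟩
    have key := integral_comp_mul_speed hs.1 hS hinv (hφ.mono (Icc_subset_Icc_right hs.2)) hmaps
      fun t ht => hd t ⟨ht.1, ht.2.trans_le hs.2⟩
    rw [hφ0] at key
    rw [← key, intervalIntegral.integral_congr (g := fun _ => (1:ℝ))]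
    · simp
    · intro t ht
      rw [uIcc_of_le hs.1] at ht
      exact inv_mul_cancel₀ (hSpos _ (hmaps ht)).ne'
  have hnn : ∀ t ∈ Icc 0 τ, 0 ≤ φ t := by
    intro t ht
    by_contra! hneg
    obtain ⟨s, hs, hφs⟩ := intermediate_value_Icc' ht.1 (hφ.mono (Icc_subset_Icc_right ht.2))
      ⟨hneg.le, hφ0 ▸ hx⟩
    have hsτ := elapsed s ⟨hs.1, hs.2.trans ht.2⟩ hφs.ge
    rw [hφs, ← hτ] at hsτ
    have hst : s = t := le_antisymm hs.2 (hsτ ▸ ht.2)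
    rw [← hst, hφs] at hneg
    exact lt_irrefl _ hneg
  have hmaps : MapsTo φ (Icc 0 τ) (Icc 0 x) := fun t ht =>
    ⟨hnn t ht, hφ0 ▸ hanti (left_mem_Icc.2 hτ0) ht ht.1⟩
  refine ⟨?_, hmaps, ?_⟩
  · refine strictAntiOn_of_deriv_neg (convex_Icc 0 τ) hφ ?_
    rw [interior_Icc]
    intro t ht
    rw [(hd t ht).deriv]
    exact neg_neg_of_pos (hSpos _ (hmaps (Ioo_subset_Icc_self ht)))
  · have hmem := hmaps (right_mem_Icc.2 hτ0)
    have hsub : ∀ {a b}, a ∈ Icc 0 x → b ∈ Icc 0 x →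
        IntervalIntegrable (fun u => (S u)⁻¹) volume a b := fun ha hb =>
      (hinv.mono (ordConnected_Icc.uIcc_subset ha hb)).intervalIntegrable
    have hi0 := hsub (left_mem_Icc.2 hx) hmem
    have hadd := intervalIntegral.integral_add_adjacent_intervals hi0
      (hsub hmem (right_mem_Icc.2 hx))
    rw [← elapsed τ (right_mem_Icc.2 hτ0) hmem.1, ← hτ] at hadd
    by_contra hne
    have := intervalIntegral.intervalIntegral_pos_of_pos_on hi0
      (fun u hu => inv_pos.2 (hSpos u ⟨hu.1.le, hu.2.le.trans hmem.2⟩))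
      (lt_of_le_of_ne hmem.1 (Ne.symm hne))
    linarith

/-- optimal response to the β₀-barrier strategy: with `x ∈ [0,β₀]`,
`y² − h(x)/c > 0`, `τ̃ = ∫₀ˣ(y² − h(ξ)/c)^{−1/2}dξ`, and `ω` solving
`ω̇ = −y − √(y² − h(x+yt+ω)/c)`, `ω(0)=0`, the trajectory `φ(t) = x + yt + ω(t)` is
strictly decreasing from `x` at `t=0` to `0` at `t=τ̃` with values in `[0,x]`, and the
hitting-time-game cost of the control `p = ((c/c₁)ω̇, −(c/c₂)ω̇)` with zero rejection
equals the value: `∫₀^τ̃ (h(φ) − c ω̇²) = g(x)`. -/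
theorem stmt12 (c1 c2 y r D : ℝ) (hc1 : 0 < c1) (hc2 : 0 < c2) (hr : 0 < r) (hD : 0 < D)
    (h : ℝ → ℝ) (hcont : ContinuousOn h (Icc 0 D)) (hmono : StrictMonoOn h (Icc 0 D))
    (hnn : ∀ u ∈ Icc (0:ℝ) D, 0 ≤ h u) (h0 : h 0 = 0)
    (hLip : ∃ K : NNReal, LipschitzOnWith K h (Icc 0 D))
    (c : ℝ) (hc : c = (c1⁻¹ + c2⁻¹)⁻¹)
    (hy : r / (4 * c) ≤ -y)
    (β₀ : ℝ) (hβmem : β₀ ∈ Icc (0:ℝ) D)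
    (hβ1 : -(r ^ 2 / (4 * c)) - r * y ≤ h D → h β₀ = -(r ^ 2 / (4 * c)) - r * y)
    (hβ2 : h D < -(r ^ 2 / (4 * c)) - r * y → β₀ = D)
    (x : ℝ) (hx : x ∈ Icc (0:ℝ) β₀) (hroot : 0 < y ^ 2 - h x / c)
    (τ : ℝ) (hτ : τ = ∫ ξ in Ioc (0:ℝ) x, (Real.sqrt (y ^ 2 - h ξ / c))⁻¹)
    (ω : ℝ → ℝ) (hωcont : ContinuousOn ω (Icc 0 τ)) (hω0 : ω 0 = 0)
    (hode : ∀ t ∈ Icc (0:ℝ) τ, HasDerivWithinAt ω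
      (-y - Real.sqrt (y ^ 2 - h (x + y * t + ω t) / c)) (Icc 0 τ) t) :
    (StrictAntiOn (fun t => x + y * t + ω t) (Icc 0 τ)
      ∧ (∀ t ∈ Icc (0:ℝ) τ, x + y * t + ω t ∈ Icc (0:ℝ) x)
      ∧ x + y * 0 + ω 0 = x
      ∧ x + y * τ + ω τ = 0)
    ∧ (∫ t in Ioc (0:ℝ) τ,
          (h (x + y * t + ω t)
            - c * (-y - Real.sqrt (y ^ 2 - h (x + y * t + ω t) / c)) ^ 2))
        = gfun c y r β₀ h x := by
  have hcpos : 0 < c := hc ▸ by positivity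
  have hxD : Icc 0 x ⊆ Icc 0 D := Icc_subset_Icc_right (hx.2.trans hβmem.2)
  set S : ℝ → ℝ := fun u => Real.sqrt (y ^ 2 - h u / c)
  have harg : ∀ u ∈ Icc 0 x, 0 < y ^ 2 - h u / c := by
    intro u hu
    have hle : h u ≤ h x := hmono.monotoneOn (hxD hu) (hxD (right_mem_Icc.2 hx.1)) hu.2
    have hdiv : h u / c ≤ h x / c := by gcongr
    linarith
  have hScont : ContinuousOn S (Icc 0 x) :=
    (continuousOn_const.sub ((hcont.mono hxD).div_const c)).sqrt
  have hSpos : ∀ u ∈ Icc 0 x, 0 < S u := fun u hu => Real.sqrt_pos.2 (harg u hu)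
  rw [← intervalIntegral.integral_of_le hx.1] at hτ
  have hτ0 : 0 ≤ τ := hτ ▸ intervalIntegral.integral_nonneg hx.1
    fun u _ => inv_nonneg.2 (Real.sqrt_nonneg _)
  set φ : ℝ → ℝ := fun t => x + y * t + ω t with hφdef
  have hφ0 : φ 0 = x := by simp [hφdef, hω0]
  have hφcont : ContinuousOn φ (Icc 0 τ) := by
    have hlin : Continuous fun t : ℝ => x + y * t := by fun_prop
    exact hlin.continuousOn.add hωcont
  have hd : ∀ t ∈ Ioo 0 τ, HasDerivAt φ (-S (φ t)) t := by
    intro t ht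
    have hω := (hode t (Ioo_subset_Icc_self ht)).hasDerivAt (Icc_mem_nhds ht.1 ht.2)
    refine ((((hasDerivAt_id t).const_mul y).const_add x).add hω).congr_deriv ?_
    change y * 1 + (-y - S (φ t)) = -S (φ t)
    ring
  obtain ⟨hanti, hmaps, hend⟩ := strictAntiOn_and_hitting_time hx.1 hScont
    (fun _ => Real.sqrt_nonneg _) hSpos hτ hφcont hφ0 hd
  refine ⟨⟨hanti, hmaps, hφ0, hend⟩, ?_⟩
  have key := integral_comp_mul_speed (k := fun u => 2 * c * (-y - S u)) hτ0 hScont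
    (continuousOn_const.mul (continuousOn_const.sub hScont)) hφcont hmaps hd
  rw [hφ0, hend] at key
  rw [gfun, if_pos hx.2, ← intervalIntegral.integral_of_le hx.1, ← key,
    ← intervalIntegral.integral_of_le hτ0]
  refine intervalIntegral.integral_congr fun t ht => ?_
  rw [uIcc_of_le hτ0] at ht
  have hsq : S (φ t) ^ 2 = y ^ 2 - h (φ t) / c := Real.sq_sqrt (harg _ (hmaps ht)).le
  have hh : h (φ t) = c * (y ^ 2 - S (φ t) ^ 2) := by
    rw [hsq]
    field_simp
    ring
  change h (φ t) - c * (-y - S (φ t)) ^ 2 = 2 * c * (-y - S (φ t)) * S (φ t)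
  rw [hh]
  ring
end
end

section
/- (Saddle point property for convex h.) Suppose −y ≥ r/(4c), and that h is in addition convex and twice continuously differentiable on [0,D]. Fix x ∈ [0,β₀), set τ̃ = ∫₀ˣ (y² − h(ξ)/c)^{−1/2} dξ, and let ω : [0,τ̃] → ℝ be continuously differentiable with ω(0) = 0 solving ω̇(t) = −y − √(y² − h(x + y t + ω(t))/c); put φ(t) = x + y t + ω(t). Let ρ : [0,∞) → [0,∞) be any nondecreasing right-continuous function such that, with τ_ρ := inf{t ≥ 0 : φ(t) − ρ(t) = 0}, one has τ_ρ < ∞, φ(τ_ρ) − ρ(τ_ρ) = 0, and φ(t) − ρ(t) ∈ [0,D] for all t ≤ τ_ρ. Then ∫₀^{τ_ρ} h(φ(t) − ρ(t)) dt + r ρ(τ_ρ) − ∫₀^{τ_ρ} c·ω̇(t)² dt ≥ g(x). (Thus against the maximizer's control built from ω, no minimizer control achieves cost below the game value g(x) = U(x).) -/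
open MeasureTheory Set Filter

noncomputable section

/-- Change of variables along a trajectory of the autonomous equation `φ' = -v(φ)`. -/
theorem integral_comp_flow {q v φ : ℝ → ℝ} {T : ℝ} {S : Set ℝ} (hT : 0 ≤ T)
    (hv : ContinuousOn v S) (hq : ContinuousOn q S) (hS : MapsTo φ (Icc 0 T) S)
    (hφ : ∀ t ∈ Icc 0 T, HasDerivWithinAt φ (-v (φ t)) (Icc 0 T) t) :
    ∫ t in (0:ℝ)..T, q (φ t) * v (φ t) = ∫ u in φ T..φ 0, q u := by
  have hcont : ContinuousOn φ (Icc 0 T) := fun t ht => (hφ t ht).continuousWithinAt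
  have key := intervalIntegral.integral_comp_mul_deriv'' (a := 0) (b := T) (f := φ)
    (f' := fun t => -v (φ t)) (g := q)
    (by rwa [uIcc_of_le hT])
    (fun t ht => by
      rw [min_eq_left hT, max_eq_right hT] at ht
      exact ((hφ t (Ioo_subset_Icc_self ht)).hasDerivAt (Icc_mem_nhds ht.1 ht.2)).hasDerivWithinAt)
    (by rw [uIcc_of_le hT]; exact (hv.comp hcont hS).neg)
    (by rw [uIcc_of_le hT]; exact hq.mono hS.image_subset)
  rw [intervalIntegral.integral_symm (φ 0) (φ T), ← key, ← intervalIntegral.integral_neg]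
  simp

/-- A trajectory of `φ' = -v(t)` with `v ≥ 0` is nonincreasing. -/
theorem antitoneOn_of_hasDerivWithinAt_neg {v φ : ℝ → ℝ} {T : ℝ} (hv : ∀ t, 0 ≤ v t)
    (hφ : ∀ t ∈ Icc 0 T, HasDerivWithinAt φ (-v t) (Icc 0 T) t) : AntitoneOn φ (Icc 0 T) := by
  have hd : ∀ t ∈ interior (Icc (0:ℝ) T), HasDerivAt φ (-v t) t := fun t ht =>
    (hφ t (interior_subset ht)).hasDerivAt (mem_interior_iff_mem_nhds.1 ht)
  refine antitoneOn_of_deriv_nonpos (convex_Icc _ _)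
    (fun t ht => (hφ t ht).continuousWithinAt)
    (fun t ht => (hd t ht).differentiableAt.differentiableWithinAt) fun t ht => ?_
  rw [(hd t ht).deriv]
  exact neg_nonpos.2 (hv t)

/-- A trajectory of `φ' = -v(φ)` that stays in `[0,x]` on the time interval needed to travel
from `x` to `0` ends at `0`. -/
theorem flow_eq_zero {v φ : ℝ → ℝ} {x τ : ℝ} (hτ0 : 0 ≤ τ)
    (hv : ContinuousOn v (Icc 0 x)) (hpos : ∀ u ∈ Icc 0 x, 0 < v u)
    (hτ : τ = ∫ u in Ioc (0:ℝ) x, (v u)⁻¹) (hS : MapsTo φ (Icc 0 τ) (Icc 0 x)) (h0 : φ 0 = x)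
    (hφ : ∀ t ∈ Icc 0 τ, HasDerivWithinAt φ (-v (φ t)) (Icc 0 τ) t) : φ τ = 0 := by
  have hq : ContinuousOn (fun u => (v u)⁻¹) (Icc 0 x) := hv.inv₀ fun u hu => (hpos u hu).ne'
  have hmem := hS (right_mem_Icc.2 hτ0)
  have hx : 0 ≤ x := hmem.1.trans hmem.2
  have key := integral_comp_flow hτ0 hv hq hS hφ
  have hone : ∫ t in (0:ℝ)..τ, (v (φ t))⁻¹ * v (φ t) = τ := by
    rw [intervalIntegral.integral_congr (g := fun _ => (1:ℝ))]
    · simp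
    · intro t ht
      rw [uIcc_of_le hτ0] at ht
      exact inv_mul_cancel₀ (hpos _ (hS ht)).ne'
  rw [hone, h0] at key
  rw [← intervalIntegral.integral_of_le hx] at hτ
  have hi : ∀ a ∈ Icc (0:ℝ) x, ∀ b ∈ Icc (0:ℝ) x,
      IntervalIntegrable (fun u => (v u)⁻¹) volume a b := fun a ha b hb =>
    (hq.mono (uIcc_subset_Icc ha hb)).intervalIntegrable
  have hadd := intervalIntegral.integral_add_adjacent_intervals
    (hi 0 (left_mem_Icc.2 hx) _ hmem) (hi _ hmem x (right_mem_Icc.2 hx))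
  by_contra hne
  have hlt : 0 < φ τ := lt_of_le_of_ne hmem.1 (Ne.symm hne)
  have := intervalIntegral.intervalIntegral_pos_of_pos_on
    (hi 0 (left_mem_Icc.2 hx) _ hmem)
    (fun u hu => inv_pos.2 (hpos u ⟨hu.1.le, hu.2.le.trans hmem.2⟩)) hlt
  linarith

/-- A convex function decreases over a step `R` to the left by at most `R` times its slope. -/
theorem ConvexOn.sub_le_mul_derivWithin {f : ℝ → ℝ} {S : Set ℝ} (hf : ConvexOn ℝ S f) {u R : ℝ}
    (hR : 0 ≤ R) (hu : u ∈ S) (huR : u - R ∈ S) (hd : DifferentiableWithinAt ℝ f S u) :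
    f u - f (u - R) ≤ R * derivWithin f S u := by
  rcases hR.eq_or_lt with rfl | hR
  · simp
  · have := hf.slope_le_derivWithin huR hu (by linarith) hd
    rwa [slope_def_field, sub_sub_cancel, div_le_iff₀' hR] at this

/-- Integrability of a continuous function along the difference of a continuous and a monotone
path with values in a compact interval. -/
theorem intervalIntegrable_comp_sub_monotone {h φ ρ : ℝ → ℝ} {D T : ℝ} (hD : 0 ≤ D) (hT : 0 ≤ T)
    (hh : ContinuousOn h (Icc 0 D)) (hφ : ContinuousOn φ (Icc 0 T))
    (hρ : MonotoneOn ρ (Icc 0 T)) (hmem : ∀ t ∈ Icc 0 T, φ t - ρ t ∈ Icc 0 D) :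
    IntervalIntegrable (fun t => h (φ t - ρ t)) volume 0 T := by
  rw [intervalIntegrable_iff_integrableOn_Icc_of_le hT]
  have hE : Continuous (IccExtend hD ((Icc 0 D).domRestrict h)) := hh.domRestrict.Icc_extend'
  have hEq : ∀ t ∈ Icc 0 T,
      IccExtend hD ((Icc 0 D).domRestrict h) (φ t - ρ t) = h (φ t - ρ t) := fun t ht => by
    rw [IccExtend_of_mem _ _ (hmem t ht), domRestrict_apply]
  obtain ⟨M, hM⟩ := isCompact_Icc.exists_bound_of_continuousOn hh
  have hmeas : AEMeasurable (fun t => φ t - ρ t) (volume.restrict (Icc 0 T)) :=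
    (hφ.aemeasurable measurableSet_Icc).sub
      (aemeasurable_restrict_of_monotoneOn measurableSet_Icc hρ)
  have hmeas' : AEStronglyMeasurable (fun t => h (φ t - ρ t)) (volume.restrict (Icc 0 T)) :=
    (hE.measurable.comp_aemeasurable hmeas).aestronglyMeasurable.congr
      ((ae_restrict_iff' measurableSet_Icc).2 (Eventually.of_forall hEq))
  refine Integrable.of_bound hmeas' M ?_
  exact (ae_restrict_iff' measurableSet_Icc).2
    (Eventually.of_forall fun t ht => hM _ (hmem t ht))

/-- The running cost along a rejection path ending at `φ T`, compared with the running cost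
without rejection. -/
theorem integral_le_integral_add_sqrt {h φ ρ : ℝ → ℝ} {c y x D T : ℝ} (hc : 0 < c)
    (hT : 0 ≤ T) (hx0 : 0 ≤ x) (hxD : x < D) (hmono : StrictMonoOn h (Icc 0 D))
    (hconv : ConvexOn ℝ (Icc 0 D) h) (hC : ContDiffOn ℝ 1 h (Icc 0 D))
    (hpos : ∀ u ∈ Icc 0 x, 0 < y ^ 2 - h u / c)
    (hS : MapsTo φ (Icc 0 T) (Icc 0 x)) (hanti : AntitoneOn φ (Icc 0 T))
    (hφ : ∀ t ∈ Icc 0 T,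
      HasDerivWithinAt φ (-√(y ^ 2 - h (φ t) / c)) (Icc 0 T) t)
    (hρ : MonotoneOn ρ (Icc 0 T)) (hρT : ρ T = φ T)
    (hmem : ∀ t ∈ Icc 0 T, φ t - ρ t ∈ Icc 0 D) :
    ∫ t in (0:ℝ)..T, h (φ t) ≤ (∫ t in (0:ℝ)..T, h (φ t - ρ t)) +
      φ T * (2 * c * √(y ^ 2 - h (φ T) / c) - 2 * c * √(y ^ 2 - h (φ 0) / c)) := by
  have hD : 0 < D := hx0.trans_lt hxD
  have hTm : T ∈ Icc 0 T := right_mem_Icc.2 hT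
  have hsub : Icc 0 x ⊆ Icc 0 D := Icc_subset_Icc_right hxD.le
  have hSD : MapsTo φ (Icc 0 T) (Icc 0 D) := hS.mono_right hsub
  have hcont : ContinuousOn φ (Icc 0 T) := fun t ht => (hφ t ht).continuousWithinAt
  have hdiff : DifferentiableOn ℝ h (Icc 0 D) := hC.differentiableOn one_ne_zero
  have hdcont : ContinuousOn (derivWithin h (Icc 0 D)) (Icc 0 D) :=
    hC.continuousOn_derivWithin (uniqueDiffOn_Icc hD) le_rfl
  set v : ℝ → ℝ := fun t => y ^ 2 - h (φ t) / c
  have hvd : ∀ t ∈ Icc 0 T,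
      HasDerivWithinAt (fun t => 2 * c * √(v t)) (derivWithin h (Icc 0 D) (φ t)) (Icc 0 T) t := by
    intro t ht
    have h1 := (hdiff _ (hSD ht)).hasDerivWithinAt.comp t (hφ t ht) hSD
    have h2 := (((h1.div_const c).const_sub (y ^ 2)).sqrt (hpos _ (hS ht)).ne').const_mul (2 * c)
    refine h2.congr_deriv ?_
    have hw := Real.sqrt_pos.2 (hpos _ (hS ht))
    simp only [Function.comp_apply]
    generalize √(y ^ 2 - h (φ t) / c) = w at hw ⊢
    field_simp
  have hdint : IntervalIntegrable (fun t => derivWithin h (Icc 0 D) (φ t)) volume 0 T := by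
    apply ContinuousOn.intervalIntegrable
    rw [uIcc_of_le hT]
    exact hdcont.comp hcont hSD
  have hFTC : ∫ t in (0:ℝ)..T, derivWithin h (Icc 0 D) (φ t) = 2 * c * √(v T) - 2 * c * √(v 0) :=
    intervalIntegral.integral_eq_sub_of_hasDerivAt_of_le hT
      (fun t ht => (hvd t ht).continuousWithinAt)
      (fun t ht => (hvd t (Ioo_subset_Icc_self ht)).hasDerivAt (Icc_mem_nhds ht.1 ht.2)) hdint
  have hint : IntervalIntegrable (fun t => h (φ t - ρ t)) volume 0 T :=
    intervalIntegrable_comp_sub_monotone hD.le hT hdiff.continuousOn hcont hρ hmem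
  have hint' : IntervalIntegrable (fun t => h (φ t)) volume 0 T := by
    apply ContinuousOn.intervalIntegrable
    rw [uIcc_of_le hT]
    exact hdiff.continuousOn.comp hcont hSD
  rw [← hFTC, ← intervalIntegral.integral_const_mul,
    ← intervalIntegral.integral_add hint (hdint.const_mul _)]
  refine intervalIntegral.integral_mono_on hT hint' (hint.add (hdint.const_mul _)) fun t ht => ?_
  have hφT : φ T ≤ φ t := hanti ht hTm ht.2
  have hρt : ρ t ≤ φ T := hρT ▸ hρ ht hTm ht.2
  have hφt := hSD ht
  have hφT0 : 0 ≤ φ T := (hSD hTm).1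
  have hmem' : φ t - φ T ∈ Icc 0 D := ⟨sub_nonneg.2 hφT, by linarith [hφt.2]⟩
  have h1 := hconv.sub_le_mul_derivWithin hφT0 hφt hmem' (hdiff _ hφt)
  have h2 := hmono.monotoneOn hmem' (hmem t ht) (by linarith)
  linarith

/-- saddle point property for convex `h`: with `x ∈ [0,β₀)`, `ω` the
maximizer's optimal-response trajectory (so `φ(t) = x + yt + ω(t)` and
`ω̇ = −y − √(y² − h(φ)/c)`), and `h` convex and `C²`, every rejection process `ρ`
that keeps `φ − ρ` in `[0,D]` up to the hitting time `τ_ρ` of `0` yields a cost at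
least `g(x)`. -/
theorem stmt13 (c1 c2 y r D : ℝ) (hc1 : 0 < c1) (hc2 : 0 < c2) (hr : 0 < r) (hD : 0 < D)
    (h : ℝ → ℝ) (hcont : ContinuousOn h (Icc 0 D)) (hmono : StrictMonoOn h (Icc 0 D))
    (hnn : ∀ u ∈ Icc (0:ℝ) D, 0 ≤ h u) (h0 : h 0 = 0)
    (hconv : ConvexOn ℝ (Icc 0 D) h) (hC2 : ContDiffOn ℝ 2 h (Icc 0 D))
    (c : ℝ) (hc : c = (c1⁻¹ + c2⁻¹)⁻¹)
    (hy : r / (4 * c) ≤ -y)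
    (β₀ : ℝ) (hβmem : β₀ ∈ Icc (0:ℝ) D)
    (hβ1 : -(r ^ 2 / (4 * c)) - r * y ≤ h D → h β₀ = -(r ^ 2 / (4 * c)) - r * y)
    (hβ2 : h D < -(r ^ 2 / (4 * c)) - r * y → β₀ = D)
    (x : ℝ) (hx : x ∈ Ico (0:ℝ) β₀)
    (τ : ℝ) (hτ : τ = ∫ ξ in Ioc (0:ℝ) x, (Real.sqrt (y ^ 2 - h ξ / c))⁻¹)
    (ω : ℝ → ℝ) (hωcont : ContinuousOn ω (Icc 0 τ)) (hω0 : ω 0 = 0)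
    (hode : ∀ t ∈ Icc (0:ℝ) τ, HasDerivWithinAt ω
      (-y - Real.sqrt (y ^ 2 - h (x + y * t + ω t) / c)) (Icc 0 τ) t)
    (ρ : IncE)
    (τρ : ℝ) (hτρ : τρ = sInf {t : ℝ | 0 ≤ t ∧ x + y * t + ω t - ρ.f t = 0})
    (hne : {t : ℝ | 0 ≤ t ∧ x + y * t + ω t - ρ.f t = 0}.Nonempty)
    (hhit : x + y * τρ + ω τρ - ρ.f τρ = 0)
    (hrange : ∀ t ∈ Icc (0:ℝ) τρ, x + y * t + ω t - ρ.f t ∈ Icc (0:ℝ) D) :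
    gfun c y r β₀ h x ≤
      (∫ t in Ioc (0:ℝ) τρ, h (x + y * t + ω t - ρ.f t)) + r * ρ.f τρ
        - ∫ t in Ioc (0:ℝ) τρ,
            c * (-y - Real.sqrt (y ^ 2 - h (x + y * t + ω t) / c)) ^ 2 := by
  have hc0 : 0 < c := hc ▸ by positivity
  obtain ⟨hx0, hxβ⟩ := hx
  have hxD : x < D := hxβ.trans_le hβmem.2
  have hsub : Icc 0 x ⊆ Icc 0 D := Icc_subset_Icc_right hxD.le
  have hβ : h β₀ ≤ -(r ^ 2 / (4 * c)) - r * y := by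
    by_cases hD' : -(r ^ 2 / (4 * c)) - r * y ≤ h D
    · exact (hβ1 hD').le
    · rw [hβ2 (not_le.1 hD')]
      exact (not_le.1 hD').le
  have hlow : ∀ u ∈ Icc 0 x, (-y - r / (2 * c)) ^ 2 < y ^ 2 - h u / c := by
    intro u hu
    have h1 : h u < -(r ^ 2 / (4 * c)) - r * y :=
      (hmono (hsub hu) hβmem (hu.2.trans_lt hxβ)).trans_le hβ
    have h2 : h u / c < (-(r ^ 2 / (4 * c)) - r * y) / c := div_lt_div_of_pos_right h1 hc0
    have h3 : (-y - r / (2 * c)) ^ 2 = y ^ 2 - (-(r ^ 2 / (4 * c)) - r * y) / c := by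
      field_simp
      ring
    linarith
  have hpos : ∀ u ∈ Icc 0 x, 0 < y ^ 2 - h u / c := fun u hu =>
    (sq_nonneg _).trans_lt (hlow u hu)
  set v : ℝ → ℝ := fun u => √(y ^ 2 - h u / c) with hv
  have hvcont : ContinuousOn v (Icc 0 x) :=
    (continuousOn_const.sub ((hcont.mono hsub).div_const c)).sqrt
  have hvpos : ∀ u ∈ Icc 0 x, 0 < v u := fun u hu => Real.sqrt_pos.2 (hpos u hu)
  set φ : ℝ → ℝ := fun t => x + y * t + ω t with hφdef
  have hφ0 : φ 0 = x := by simp [hφdef, hω0]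
  have hφd : ∀ t ∈ Icc 0 τ, HasDerivWithinAt φ (-v (φ t)) (Icc 0 τ) t := by
    intro t ht
    refine ((((hasDerivWithinAt_id t _).const_mul y).const_add x).add (hode t ht)).congr_deriv ?_
    simp only [hv, hφdef]
    ring
  have hanti : AntitoneOn φ (Icc 0 τ) :=
    antitoneOn_of_hasDerivWithinAt_neg (v := fun t => v (φ t)) (fun t => Real.sqrt_nonneg _) hφd
  have hτ0 : 0 ≤ τ := hτ ▸ integral_nonneg fun u => inv_nonneg.2 (Real.sqrt_nonneg _)
  have hτmem : (0:ℝ) ∈ Icc 0 τ := left_mem_Icc.2 hτ0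
  have hT0 : 0 ≤ τρ := hτρ ▸ le_csInf hne fun t ht => ht.1
  have hle : τρ ≤ τ := by
    by_contra! hlt
    have hS : MapsTo φ (Icc 0 τ) (Icc 0 x) := fun t ht =>
      ⟨by linarith [(hrange t ⟨ht.1, ht.2.trans hlt.le⟩).1, ρ.nonneg t],
        hφ0 ▸ hanti hτmem ht ht.1⟩
    have hφτ : φ τ = 0 := flow_eq_zero hτ0 hvcont hvpos hτ hS hφ0 hφd
    have hmem : τ ∈ {t : ℝ | 0 ≤ t ∧ x + y * t + ω t - ρ.f t = 0} :=
      ⟨hτ0, le_antisymm (by linarith [ρ.nonneg τ]) (hrange τ ⟨hτ0, hlt.le⟩).1⟩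
    have := csInf_le ⟨0, fun t ht => ht.1⟩ hmem
    linarith
  have hIcc : Icc 0 τρ ⊆ Icc 0 τ := Icc_subset_Icc_right hle
  have hTm : τρ ∈ Icc 0 τρ := right_mem_Icc.2 hT0
  have hanti' : AntitoneOn φ (Icc 0 τρ) := hanti.mono hIcc
  have hS : MapsTo φ (Icc 0 τρ) (Icc 0 x) := fun t ht =>
    ⟨by linarith [(hrange t ht).1, ρ.nonneg t], hφ0 ▸ hanti hτmem (hIcc ht) ht.1⟩
  have hφd' : ∀ t ∈ Icc 0 τρ, HasDerivWithinAt φ (-v (φ t)) (Icc 0 τρ) t := fun t ht =>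
    (hφd t (hIcc ht)).mono hIcc
  have hφcont : ContinuousOn φ (Icc 0 τρ) := fun t ht => (hφd' t ht).continuousWithinAt
  have hρT : ρ.f τρ = φ τρ := by linarith
  obtain ⟨hR0, hRx⟩ := hS hTm
  have hrun := integral_le_integral_add_sqrt hc0 hT0 hx0 hxD hmono hconv
    (hC2.of_le one_le_two) hpos hS hanti' hφd' (ρ.mono.mono Icc_subset_Ici_self) hρT hrange
  set q : ℝ → ℝ := fun u => 2 * c * (-y - v u) with hq
  have hqcont : ContinuousOn q (Icc 0 x) :=
    continuousOn_const.mul (continuousOn_const.sub hvcont)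
  have hrate : ∫ t in (0:ℝ)..τρ, c * (-y - v (φ t)) ^ 2 =
      (∫ t in (0:ℝ)..τρ, h (φ t)) - ∫ u in φ τρ..x, q u := by
    have hi1 : IntervalIntegrable (fun t => h (φ t)) volume 0 τρ := by
      apply ContinuousOn.intervalIntegrable
      rw [uIcc_of_le hT0]
      exact (hcont.mono hsub).comp hφcont hS
    have hi2 : IntervalIntegrable (fun t => q (φ t) * v (φ t)) volume 0 τρ := by
      apply ContinuousOn.intervalIntegrable
      rw [uIcc_of_le hT0]
      exact (hqcont.comp hφcont hS).mul (hvcont.comp hφcont hS)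
    rw [← hφ0, ← integral_comp_flow hT0 hvcont hqcont hS hφd',
      ← intervalIntegral.integral_sub hi1 hi2]
    refine intervalIntegral.integral_congr fun t ht => ?_
    rw [uIcc_of_le hT0] at ht
    have hsq : v (φ t) ^ 2 = y ^ 2 - h (φ t) / c := Real.sq_sqrt (hpos _ (hS ht)).le
    have hh : h (φ t) = c * (y ^ 2 - v (φ t) ^ 2) := by
      rw [hsq]
      field_simp
      ring
    simp only [hq]
    rw [hh]
    ring
  have hqi : ∀ a ∈ Icc 0 x, ∀ b ∈ Icc 0 x, IntervalIntegrable q volume a b := fun a ha b hb =>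
    (hqcont.mono (uIcc_subset_Icc ha hb)).intervalIntegrable
  have hxm : x ∈ Icc 0 x := right_mem_Icc.2 hx0
  have h0m : (0:ℝ) ∈ Icc 0 x := left_mem_Icc.2 hx0
  have hadd := intervalIntegral.integral_add_adjacent_intervals
    (hqi 0 h0m _ ⟨hR0, hRx⟩) (hqi _ ⟨hR0, hRx⟩ x hxm)
  have hqR : ∫ u in (0:ℝ)..φ τρ, q u ≤ φ τρ * q (φ τρ) := by
    calc ∫ u in (0:ℝ)..φ τρ, q u ≤ ∫ _ in (0:ℝ)..φ τρ, q (φ τρ) := by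
          refine intervalIntegral.integral_mono_on hR0 (hqi 0 h0m _ ⟨hR0, hRx⟩)
            intervalIntegrable_const fun u hu => ?_
          have hhu : h u ≤ h (φ τρ) := hmono.monotoneOn (hsub ⟨hu.1, hu.2.trans hRx⟩)
            (hsub ⟨hR0, hRx⟩) hu.2
          have hvu : v (φ τρ) ≤ v u := Real.sqrt_le_sqrt
            (sub_le_sub_left (div_le_div_of_nonneg_right hhu hc0.le) _)
          exact mul_le_mul_of_nonneg_left (by linarith) (by positivity)
      _ = φ τρ * q (φ τρ) := by simp
  have hvx : q x ≤ r := by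
    have h1 : -y - r / (2 * c) ≤ v x := Real.le_sqrt_of_sq_le (hlow x hxm).le
    calc q x ≤ 2 * c * (r / (2 * c)) := mul_le_mul_of_nonneg_left (by linarith) (by positivity)
      _ = r := by field_simp
  have hfin : φ τρ * q x ≤ φ τρ * r := mul_le_mul_of_nonneg_left hvx hR0
  rw [gfun, if_pos hxβ.le, ← intervalIntegral.integral_of_le hx0,
    ← intervalIntegral.integral_of_le hT0, ← intervalIntegral.integral_of_le hT0]
  change ∫ u in (0:ℝ)..x, q u ≤ (∫ t in (0:ℝ)..τρ, h (φ t - ρ.f t)) + r * ρ.f τρ -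
    ∫ t in (0:ℝ)..τρ, c * (-y - v (φ t)) ^ 2
  rw [hφ0] at hrun
  change _ ≤ _ + φ τρ * (2 * c * v (φ τρ) - 2 * c * v x) at hrun
  rw [hrate, hρT]
  simp only [hq] at hqR hfin hadd ⊢
  linarith
end
end

section
/- (Front-loading rejections is optimal for the minimizer against the maximizer's optimal control.) Suppose −y ≥ r/(4c). Fix x ∈ [0,β₀), set τ̃ = ∫₀ˣ (y² − h(ξ)/c)^{−1/2} dξ, and let ω : [0,τ̃] → ℝ be continuously differentiable with ω(0) = 0 solving ω̇(t) = −y − √(y² − h(x + y t + ω(t))/c); put φ(t) = x + y t + ω(t), which is strictly decreasing from x to 0. Let ρ : [0,∞) → [0,∞) be nondecreasing and right-continuous such that, with τ_ρ := inf{t ≥ 0 : φ(t) − ρ(t) = 0}, one has τ_ρ < ∞, φ(τ_ρ) − ρ(τ_ρ) = 0, and φ(t) − ρ(t) ∈ [0,D] for all t ≤ τ_ρ. Set P := ρ(τ_ρ) and let T(P) be the unique time in [0,τ̃] with φ(T(P)) = P. Then τ_ρ = T(P), and the cost of ρ dominates the cost of rejecting the amount P at time zero: ∫₀^{τ_ρ}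 h(φ(t) − ρ(t)) dt + r ρ(τ_ρ) − ∫₀^{τ_ρ} c·ω̇(t)² dt ≥ ∫₀^{T(P)} h(φ(t) − P) dt + r P − ∫₀^{T(P)} c·ω̇(t)² dt. -/
open MeasureTheory Set Filter

noncomputable section

/-- A function satisfying the autonomous equation `φ' = -v(φ)`, started at `x ≥ 0`, with speed `v`
positive on `[0, x]`, decreases strictly to `0` within the travel time `∫₀ˣ 1 / v`. -/
lemma strictAntiOn_and_eq_zero_of_hasDerivWithinAt_neg_speed {v φ : ℝ → ℝ} {x τ : ℝ} (hx : 0 ≤ x)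
    (hτ0 : 0 ≤ τ) (hv : ContinuousOn v (Icc 0 x)) (hpos : ∀ u ∈ Icc 0 x, 0 < v u)
    (hv0 : ∀ u, 0 ≤ v u) (hτ : τ = ∫ ξ in Ioc 0 x, (v ξ)⁻¹) (hφ0 : φ 0 = x)
    (hφ : ∀ t ∈ Icc 0 τ, HasDerivWithinAt φ (-v (φ t)) (Icc 0 τ) t) :
    StrictAntiOn φ (Icc 0 τ) ∧ φ τ = 0 := by
  have hφc : ContinuousOn φ (Icc 0 τ) := fun t ht => (hφ t ht).continuousWithinAt
  have hanti : AntitoneOn φ (Icc 0 τ) := by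
    have hd : ∀ t ∈ interior (Icc 0 τ), HasDerivAt φ (-v (φ t)) t := fun t ht =>
      (hφ t (interior_subset ht)).hasDerivAt (mem_interior_iff_mem_nhds.1 ht)
    refine antitoneOn_of_deriv_nonpos (convex_Icc 0 τ) hφc
      (fun t ht => (hd t ht).differentiableAt.differentiableWithinAt) fun t ht => ?_
    rw [(hd t ht).deriv]
    linarith [hv0 (φ t)]
  have hle : ∀ t ∈ Icc 0 τ, φ t ≤ x := fun t ht =>
    hφ0 ▸ hanti (left_mem_Icc.2 hτ0) ht ht.1
  let g : ℝ → ℝ := IccExtend hx ((Icc 0 x).domRestrict fun u => (v u)⁻¹)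
  have hgeq : ∀ u ∈ Icc 0 x, g u = (v u)⁻¹ := fun u hu => by
    simp only [g, IccExtend_of_mem hx _ hu, domRestrict_apply]
  have hgpos : ∀ u, 0 < g u := fun u => inv_pos.2 (hpos _ (projIcc 0 x hx u).2)
  have hgc : Continuous g :=
    (continuousOn_iff_continuous_domRestrict.1 (hv.inv₀ fun u hu => (hpos u hu).ne')).Icc_extend'
  let G : ℝ → ℝ := fun u => ∫ ξ in (0:ℝ)..u, g ξ
  have hG : ∀ u, HasDerivAt G (g u) u := fun u => hgc.integral_hasStrictDerivAt 0 u |>.hasDerivAt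
  have hGmono : StrictMono G := strictMono_of_deriv_pos fun u => by
    rw [(hG u).deriv]; exact hgpos u
  have hG0 : G 0 = 0 := intervalIntegral.integral_same
  have hGx : G x = τ := by
    rw [hτ, ← intervalIntegral.integral_of_le hx]
    exact intervalIntegral.integral_congr fun u hu => hgeq u (by rwa [uIcc_of_le hx] at hu)
  have key : ∀ s ∈ Icc 0 τ, 0 ≤ φ s → G (φ s) = τ - s := by
    intro s hs hφs
    have hsub : Icc 0 s ⊆ Icc 0 τ := Icc_subset_Icc_right hs.2
    have := constant_of_has_deriv_right_zero (f := fun t => G (φ t) + t) (a := 0) (b := s)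
      (ContinuousOn.add (fun t ht => (hG _).continuousAt.comp_continuousWithinAt
        ((hφc.mono hsub) t ht)) continuousOn_id) (fun t ht => by
        have ht' : t ∈ Icc 0 τ := ⟨ht.1, ht.2.le.trans hs.2⟩
        have hmem : φ t ∈ Icc 0 x := ⟨hφs.trans (hanti ht' hs ht.2.le), hle t ht'⟩
        have hd : HasDerivWithinAt φ (-v (φ t)) (Ici t) t :=
          ((hφ t ht').mono (Icc_subset_Icc_left ht.1)).mono_of_mem_nhdsWithin
            (Icc_mem_nhdsGE (ht.2.trans_le hs.2))
        have := ((hG (φ t)).comp_hasDerivWithinAt t hd).add (hasDerivWithinAt_id t _)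
        rw [hgeq _ hmem, mul_neg, inv_mul_cancel₀ (hpos _ hmem).ne', neg_add_cancel] at this
        exact this) s (right_mem_Icc.2 hs.1)
    simp only [hφ0, hGx, add_zero] at this
    linarith
  have hnn : ∀ t ∈ Icc 0 τ, 0 ≤ φ t := by
    intro t ht
    by_contra! hneg
    obtain ⟨s, hs, hs0⟩ := intermediate_value_Icc' ht.1
      (hφc.mono (Icc_subset_Icc_right ht.2)) ⟨hneg.le, hφ0 ▸ hx⟩
    have := key s ⟨hs.1, hs.2.trans ht.2⟩ hs0.ge
    rw [hs0, hG0] at this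
    have : t = s := by linarith [hs.2, ht.2]
    exact hneg.ne (this ▸ hs0)
  refine ⟨fun s hs t ht hst => hGmono.lt_iff_lt.1 ?_, hGmono.injective ?_⟩
  · rw [key s hs (hnn s hs), key t ht (hnn t ht)]
    linarith
  · rw [key τ (right_mem_Icc.2 hτ0) (hnn τ (right_mem_Icc.2 hτ0)), hG0, sub_self]

/-- A function that is continuous on `[0, D]`, composed with a measurable path in `[0, D]`, is
integrable on bounded intervals. -/
lemma integrableOn_comp_of_continuousOn_Icc {h ψ : ℝ → ℝ} {D T : ℝ} (hD : 0 ≤ D)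
    (hh : ContinuousOn h (Icc 0 D)) (hψ : AEMeasurable ψ (volume.restrict (Ioc 0 T)))
    (hmem : ∀ t ∈ Ioc 0 T, ψ t ∈ Icc 0 D) :
    IntegrableOn (fun t => h (ψ t)) (Ioc 0 T) := by
  have hc : Continuous (IccExtend hD ((Icc 0 D).domRestrict h)) :=
    (continuousOn_iff_continuous_domRestrict.1 hh).Icc_extend'
  have hae : ∀ᵐ t ∂volume.restrict (Ioc 0 T),
      IccExtend hD ((Icc 0 D).domRestrict h) (ψ t) = h (ψ t) :=
    (ae_restrict_iff' measurableSet_Ioc).2 <| .of_forall fun t ht => by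
      simp only [IccExtend_of_mem hD _ (hmem t ht), domRestrict_apply]
  obtain ⟨C, hC⟩ := isCompact_Icc.exists_bound_of_continuousOn hh
  refine Integrable.of_bound
    ((hc.measurable.comp_aemeasurable hψ).congr hae).aestronglyMeasurable C ?_
  exact (ae_restrict_iff' measurableSet_Ioc).2 <| .of_forall fun t ht => hC _ (hmem t ht)

/-- front-loading rejections is optimal against the maximizer's optimal
control: with `x ∈ [0,β₀)`, `ω` the maximizer's optimal trajectory,
`φ(t) = x + yt + ω(t)` strictly decreasing from `x` to `0` on `[0,τ̃]`, a rejection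
process `ρ` with total rejection `P = ρ(τ_ρ)`, and `T(P)` the unique time with
`φ(T(P)) = P`, one has `τ_ρ = T(P)` and the cost of `ρ` dominates the cost of
rejecting `P` at time zero. -/
theorem stmt14 (c1 c2 y r D : ℝ) (hc1 : 0 < c1) (hc2 : 0 < c2) (hr : 0 < r) (hD : 0 < D)
    (h : ℝ → ℝ) (hcont : ContinuousOn h (Icc 0 D)) (hmono : StrictMonoOn h (Icc 0 D))
    (hnn : ∀ u ∈ Icc (0:ℝ) D, 0 ≤ h u) (h0 : h 0 = 0)
    (c : ℝ) (hc : c = (c1⁻¹ + c2⁻¹)⁻¹)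
    (hy : r / (4 * c) ≤ -y)
    (β₀ : ℝ) (hβmem : β₀ ∈ Icc (0:ℝ) D)
    (hβ1 : -(r ^ 2 / (4 * c)) - r * y ≤ h D → h β₀ = -(r ^ 2 / (4 * c)) - r * y)
    (hβ2 : h D < -(r ^ 2 / (4 * c)) - r * y → β₀ = D)
    (x : ℝ) (hx : x ∈ Ico (0:ℝ) β₀)
    (τ : ℝ) (hτ : τ = ∫ ξ in Ioc (0:ℝ) x, (Real.sqrt (y ^ 2 - h ξ / c))⁻¹)
    (ω : ℝ → ℝ) (hωcont : ContinuousOn ω (Icc 0 τ)) (hω0 : ω 0 = 0)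
    (hode : ∀ t ∈ Icc (0:ℝ) τ, HasDerivWithinAt ω
      (-y - Real.sqrt (y ^ 2 - h (x + y * t + ω t) / c)) (Icc 0 τ) t)
    (ρ : IncE)
    (τρ : ℝ) (hτρ : τρ = sInf {t : ℝ | 0 ≤ t ∧ x + y * t + ω t - ρ.f t = 0})
    (hne : {t : ℝ | 0 ≤ t ∧ x + y * t + ω t - ρ.f t = 0}.Nonempty)
    (hhit : x + y * τρ + ω τρ - ρ.f τρ = 0)
    (hrange : ∀ t ∈ Icc (0:ℝ) τρ, x + y * t + ω t - ρ.f t ∈ Icc (0:ℝ) D)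
    (P : ℝ) (hP : P = ρ.f τρ)
    (TP : ℝ) (hTP : TP ∈ Icc (0:ℝ) τ) (hTPhit : x + y * TP + ω TP = P) :
    τρ = TP ∧
      (∫ t in Ioc (0:ℝ) TP, h (x + y * t + ω t - P)) + r * P
          - (∫ t in Ioc (0:ℝ) TP,
              c * (-y - Real.sqrt (y ^ 2 - h (x + y * t + ω t) / c)) ^ 2)
        ≤ (∫ t in Ioc (0:ℝ) τρ, h (x + y * t + ω t - ρ.f t)) + r * ρ.f τρ
          - ∫ t in Ioc (0:ℝ) τρ,
              c * (-y - Real.sqrt (y ^ 2 - h (x + y * t + ω t) / c)) ^ 2 := by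
  have hcpos : 0 < c := by rw [hc]; positivity
  have hD0 : (0:ℝ) ≤ D := hD.le
  have hxD : x ≤ D := hx.2.le.trans hβmem.2
  have hsub : Icc 0 x ⊆ Icc 0 D := Icc_subset_Icc_right hxD
  have hhβ : h β₀ ≤ -(r ^ 2 / (4 * c)) - r * y := by
    rcases le_or_gt (-(r ^ 2 / (4 * c)) - r * y) (h D) with hcase | hcase
    · exact (hβ1 hcase).le
    · exact hβ2 hcase ▸ hcase.le
  have hpos : ∀ u ∈ Icc (0:ℝ) x, 0 < y ^ 2 - h u / c := by
    intro u hu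
    have h1 : h u < h β₀ := hmono (hsub hu) hβmem (hu.2.trans_lt hx.2)
    have h2 : (-(r ^ 2 / (4 * c)) - r * y) / c = y ^ 2 - (y + r / (2 * c)) ^ 2 := by
      field_simp
      ring
    have h3 : h u / c < (-(r ^ 2 / (4 * c)) - r * y) / c := by gcongr; linarith
    nlinarith [sq_nonneg (y + r / (2 * c))]
  have hτ0 : 0 ≤ τ := hTP.1.trans hTP.2
  obtain ⟨hφanti, hφτ⟩ := strictAntiOn_and_eq_zero_of_hasDerivWithinAt_neg_speed
    (v := fun u => Real.sqrt (y ^ 2 - h u / c)) (φ := fun t => x + y * t + ω t) hx.1 hτ0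
    ((continuousOn_const.sub ((hcont.mono hsub).div_const c)).sqrt)
    (fun u hu => Real.sqrt_pos.2 (hpos u hu)) (fun u => Real.sqrt_nonneg _) hτ
    (by simp [hω0]) (fun t ht => by
      have := (((hasDerivWithinAt_id t (Icc 0 τ)).const_mul y).const_add x).add (hode t ht)
      exact this.congr_deriv (by ring))
  have hτρ0 : 0 ≤ τρ := hτρ ▸ Real.sInf_nonneg fun t ht => ht.1
  have hτρτ : τρ ≤ τ := by
    by_contra! hlt
    have h1 := (hrange τ ⟨hτ0, hlt.le⟩).1
    have h2 := ρ.nonneg τ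
    refine hlt.not_ge (hτρ ▸ csInf_le ⟨0, fun t ht => ht.1⟩ ⟨hτ0, ?_⟩)
    linarith
  have hT : τρ = TP := hφanti.injOn ⟨hτρ0, hτρτ⟩ hTP (by linarith)
  subst hT
  refine ⟨rfl, ?_⟩
  have hP0 : 0 ≤ P := hP ▸ ρ.nonneg τρ
  have hmemP : ∀ t ∈ Ioc 0 τρ, x + y * t + ω t - P ∈ Icc 0 D := by
    intro t ht
    have htτ : t ∈ Icc 0 τ := ⟨ht.1.le, ht.2.trans hτρτ⟩
    have h1 := hφanti.antitoneOn htτ hTP ht.2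
    have h2 := hφanti.antitoneOn (left_mem_Icc.2 hτ0) htτ ht.1.le
    simp only [hω0, mul_zero, add_zero] at h1 h2
    constructor <;> linarith
  have hmemρ : ∀ t ∈ Ioc 0 τρ, x + y * t + ω t - ρ.f t ∈ Icc 0 D := fun t ht =>
    hrange t (Ioc_subset_Icc_self ht)
  have hφm : AEMeasurable (fun t => x + y * t + ω t) (volume.restrict (Ioc 0 τρ)) :=
    ((Continuous.continuousOn (by fun_prop)).add
      (hωcont.mono (Ioc_subset_Icc_self.trans (Icc_subset_Icc_right hτρτ)))).aemeasurable
      measurableSet_Ioc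
  have hρm : AEMeasurable ρ.f (volume.restrict (Ioc 0 τρ)) :=
    aemeasurable_restrict_of_monotoneOn measurableSet_Ioc
      (ρ.mono.mono fun t ht => ht.1.le)
  have hint := setIntegral_mono_on
    (integrableOn_comp_of_continuousOn_Icc hD0 hcont (hφm.sub_const P) hmemP)
    (integrableOn_comp_of_continuousOn_Icc hD0 hcont (hφm.sub hρm) hmemρ)
    measurableSet_Ioc fun t ht => by
      refine hmono.monotoneOn (hmemP t ht) (hmemρ t ht) ?_
      have := ρ.mono (mem_Ici.2 ht.1.le) (mem_Ici.2 hτρ0) ht.2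
      simp only [Pi.sub_apply]
      linarith
  simp only [Pi.sub_apply] at hint
  rw [← hP]
  linarith
end
end

section
/- If r²/(4c) + r y ≤ 0, then for all real numbers p and q, r·max(p − q + y, 0) − c₁ p² − c₂ q² ≤ 0; equivalently, r·max(p − q + y, 0) ≤ c₁ p² + c₂ q² for all p, q ∈ ℝ. -/
/-- If `r²/(4c) + r·y ≤ 0`, then for all real `p q`,
`r·max(p − q + y, 0) ≤ c₁ p² + c₂ q²`, where `c = (c₁⁻¹ + c₂⁻¹)⁻¹`. -/
theorem stmt16 (c1 c2 y r : ℝ) (hc1 : 0 < c1) (hc2 : 0 < c2) (hr : 0 < r)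
    (c : ℝ) (hc : c = (c1⁻¹ + c2⁻¹)⁻¹)
    (hy : r ^ 2 / (4 * c) + r * y ≤ 0) :
    ∀ p q : ℝ, r * max (p - q + y) 0 ≤ c1 * p ^ 2 + c2 * q ^ 2 := by
  intro p q
  have split : r ^ 2 / (4 * c) = r ^ 2 / (4 * c1) + r ^ 2 / (4 * c2) := by
    subst hc
    field_simp
  have square_p : c1 * p ^ 2 - r * p + r ^ 2 / (4 * c1) = c1 * (p - r / (2 * c1)) ^ 2 := by
    field_simp
    ring
  have square_q : c2 * q ^ 2 + r * q + r ^ 2 / (4 * c2) = c2 * (q + r / (2 * c2)) ^ 2 := by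
    field_simp
    ring
  have nonneg_p : 0 ≤ c1 * (p - r / (2 * c1)) ^ 2 := by positivity
  have nonneg_q : 0 ≤ c2 * (q + r / (2 * c2)) ^ 2 := by positivity
  rcases max_cases (p - q + y) 0 with ⟨h, _⟩ | ⟨h, _⟩ <;> rw [h]
  · linarith
  · rw [mul_zero]
    positivity
end

section
/- (g is a classical solution away from the free boundary.) Suppose −y ≥ r/(4c). Then for every x ∈ [0,β₀]: (i) y² − h(x)/c ≥ 0, so that G(x) := 2c(−y − √(y² − h(x)/c)) is well defined; (ii) G(x) ≥ 0; (iii) −G(x)²/(4c) − y·G(x) − h(x) = 0; and (iv) G(x) ≤ r. Consequently, g(x) = ∫₀ˣ G(u) du is nondecreasing on [0,β₀], is continuously differentiable on (0,β₀) with g′ = G there, and satisfies both −g′(x)²/(4c) − y g′(x) − h(x) = 0 and g′(x) − r ≤ 0 on (0,β₀). -/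
open MeasureTheory Set

noncomputable section

/-- The slope of the candidate value function at a point where `h` takes the value `a`. -/
def candidateSlope (c y a : ℝ) : ℝ :=
  2 * c * (-y - Real.sqrt (y ^ 2 - a / c))

theorem sq_le_sq_sub_div {c y r a : ℝ} (hc : 0 < c) (ha : a ≤ -(r ^ 2 / (4 * c)) - r * y) :
    (-y - r / (2 * c)) ^ 2 ≤ y ^ 2 - a / c := by
  have h1 : a / c ≤ (-(r ^ 2 / (4 * c)) - r * y) / c := by gcongr
  have h2 : y ^ 2 - (-(r ^ 2 / (4 * c)) - r * y) / c = (-y - r / (2 * c)) ^ 2 := by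
    field_simp
    ring
  linarith

theorem candidateSlope_nonneg {c y a : ℝ} (hc : 0 < c) (hy : y ≤ 0) (ha : 0 ≤ a) :
    0 ≤ candidateSlope c y a := by
  have h1 : Real.sqrt (y ^ 2 - a / c) ≤ -y :=
    Real.sqrt_le_iff.2 ⟨by linarith, by have := div_nonneg ha hc.le; nlinarith⟩
  exact mul_nonneg (by positivity) (by linarith)

theorem candidateSlope_le {c y r a : ℝ} (hc : 0 < c) (ha : a ≤ -(r ^ 2 / (4 * c)) - r * y) :
    candidateSlope c y a ≤ r := by
  have h1 : -y - r / (2 * c) ≤ Real.sqrt (y ^ 2 - a / c) :=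
    Real.le_sqrt_of_sq_le (sq_le_sq_sub_div hc ha)
  calc candidateSlope c y a ≤ 2 * c * (r / (2 * c)) := by
        unfold candidateSlope
        gcongr
        linarith
    _ = r := by field_simp

theorem candidateSlope_equation {c y a : ℝ} (hc : 0 < c) (ha : 0 ≤ y ^ 2 - a / c) :
    -candidateSlope c y a ^ 2 / (4 * c) - y * candidateSlope c y a - a = 0 := by
  have h1 := Real.sq_sqrt ha
  unfold candidateSlope
  set s := Real.sqrt (y ^ 2 - a / c)
  have h2 : a = c * (y ^ 2 - s ^ 2) := by
    rw [h1]
    field_simp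
    ring
  rw [h2]
  field_simp
  ring

theorem continuousOn_candidateSlope {c y : ℝ} {h : ℝ → ℝ} {s : Set ℝ} (hh : ContinuousOn h s) :
    ContinuousOn (fun u => candidateSlope c y (h u)) s :=
  continuousOn_const.mul
    (continuousOn_const.sub (continuousOn_const.sub (hh.div_const c)).sqrt)

theorem gfun_of_le {c y r b x : ℝ} {h : ℝ → ℝ} (hx : x ≤ b) :
    gfun c y r b h x = ∫ u in Ioc (0:ℝ) x, candidateSlope c y (h u) :=
  if_pos hx

theorem monotoneOn_gfun {c y r b : ℝ} {h : ℝ → ℝ} (hh : ContinuousOn h (Icc 0 b))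
    (hnn : ∀ u ∈ Icc (0:ℝ) b, 0 ≤ candidateSlope c y (h u)) :
    MonotoneOn (gfun c y r b h) (Icc 0 b) := by
  intro u _ v hv huv
  rw [gfun_of_le (huv.trans hv.2), gfun_of_le hv.2]
  have hsub : Ioc 0 v ⊆ Icc 0 b := Ioc_subset_Icc_self.trans (Icc_subset_Icc_right hv.2)
  refine setIntegral_mono_set
    ((continuousOn_candidateSlope hh).integrableOn_Icc.mono_set hsub) ?_
    (Ioc_subset_Ioc_right huv).eventuallyLE
  filter_upwards [ae_restrict_mem measurableSet_Ioc] with w hw using hnn w (hsub hw)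

theorem hasDerivAt_gfun {c y r b x : ℝ} {h : ℝ → ℝ} (hh : ContinuousOn h (Icc 0 b))
    (hx : x ∈ Ioo 0 b) :
    HasDerivAt (gfun c y r b h) (candidateSlope c y (h x)) x := by
  have hG : ContinuousOn (fun u => candidateSlope c y (h u)) (Icc 0 b) :=
    continuousOn_candidateSlope hh
  have hint : IntervalIntegrable (fun u => candidateSlope c y (h u)) volume 0 x :=
    (hG.mono (Icc_subset_Icc_right hx.2.le)).intervalIntegrable_of_Icc hx.1.le
  refine (intervalIntegral.integral_hasDerivAt_right hint
    ((hG.mono Ioo_subset_Icc_self).stronglyMeasurableAtFilter isOpen_Ioo x hx)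
    (hG.continuousAt (Icc_mem_nhds hx.1 hx.2))).congr_of_eventuallyEq ?_
  filter_upwards [Ioo_mem_nhds hx.1 hx.2] with z hz
  rw [gfun_of_le hz.2.le, intervalIntegral.integral_of_le hz.1.le]

/-- `g` is a classical solution away from the free boundary: for
`x ∈ [0,β₀]`, with `G(x) = 2c(−y − √(y² − h(x)/c))`: (i) `y² − h(x)/c ≥ 0`;
(ii) `G(x) ≥ 0`; (iii) `−G(x)²/(4c) − yG(x) − h(x) = 0`; (iv) `G(x) ≤ r`.
Consequently `g = ∫₀^· G` is nondecreasing on `[0,β₀]` and continuously differentiable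
on `(0,β₀)` with `g′ = G`, so that `−g′²/(4c) − yg′ − h = 0` and `g′ ≤ r` there. -/
theorem stmt17 (c1 c2 y r D : ℝ) (hc1 : 0 < c1) (hc2 : 0 < c2) (hr : 0 < r) (hD : 0 < D)
    (h : ℝ → ℝ) (hcont : ContinuousOn h (Icc 0 D)) (hmono : StrictMonoOn h (Icc 0 D))
    (hnn : ∀ u ∈ Icc (0:ℝ) D, 0 ≤ h u) (h0 : h 0 = 0)
    (c : ℝ) (hc : c = (c1⁻¹ + c2⁻¹)⁻¹)
    (hy : r / (4 * c) ≤ -y)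
    (β₀ : ℝ) (hβmem : β₀ ∈ Icc (0:ℝ) D)
    (hβ1 : -(r ^ 2 / (4 * c)) - r * y ≤ h D → h β₀ = -(r ^ 2 / (4 * c)) - r * y)
    (hβ2 : h D < -(r ^ 2 / (4 * c)) - r * y → β₀ = D) :
    (∀ x ∈ Icc (0:ℝ) β₀,
      0 ≤ y ^ 2 - h x / c
      ∧ 0 ≤ 2 * c * (-y - Real.sqrt (y ^ 2 - h x / c))
      ∧ -(2 * c * (-y - Real.sqrt (y ^ 2 - h x / c))) ^ 2 / (4 * c)
          - y * (2 * c * (-y - Real.sqrt (y ^ 2 - h x / c))) - h x = 0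
      ∧ 2 * c * (-y - Real.sqrt (y ^ 2 - h x / c)) ≤ r)
    ∧ MonotoneOn (gfun c y r β₀ h) (Icc (0:ℝ) β₀)
    ∧ (∀ x ∈ Ioo (0:ℝ) β₀,
        HasDerivAt (gfun c y r β₀ h) (2 * c * (-y - Real.sqrt (y ^ 2 - h x / c))) x) := by
  have hcpos : 0 < c := hc ▸ by positivity
  have hy0 : y ≤ 0 := by
    have : 0 ≤ r / (4 * c) := by positivity
    linarith
  have hβ : h β₀ ≤ -(r ^ 2 / (4 * c)) - r * y := by
    rcases le_or_gt (-(r ^ 2 / (4 * c)) - r * y) (h D) with hle | hlt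
    · exact (hβ1 hle).le
    · exact hβ2 hlt ▸ hlt.le
  have hsub : Icc 0 β₀ ⊆ Icc 0 D := Icc_subset_Icc_right hβmem.2
  have hle : ∀ x ∈ Icc (0:ℝ) β₀, h x ≤ -(r ^ 2 / (4 * c)) - r * y := fun x hx =>
    (hmono.monotoneOn (hsub hx) hβmem hx.2).trans hβ
  have hG : ∀ x ∈ Icc (0:ℝ) β₀, 0 ≤ candidateSlope c y (h x) := fun x hx =>
    candidateSlope_nonneg hcpos hy0 (hnn x (hsub hx))
  refine ⟨fun x hx => ?_, monotoneOn_gfun (hcont.mono hsub) hG,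
    fun x hx => hasDerivAt_gfun (hcont.mono hsub) hx⟩
  have hrad : 0 ≤ y ^ 2 - h x / c := (sq_nonneg _).trans (sq_le_sq_sub_div hcpos (hle x hx))
  exact ⟨hrad, hG x hx, candidateSlope_equation hcpos hrad, candidateSlope_le hcpos (hle x hx)⟩
end
end

section
/- (Differentiability of g at the free boundary.) Suppose −y ≥ r/(4c) and r²/(4c) + r y ≥ −h(D), so that β₀ ∈ [0,D] satisfies h(β₀) = −r²/(4c) − r y. Then y² − h(β₀)/c = (y + r/(2c))², and the left-derivative of g at β₀ equals g′_L(β₀) = 2c(−y − |y + r/(2c)|) = min(r, −4cy − r). In particular g′_L(β₀) = r if and only if −y ≥ r/(2c), and if −y < r/(2c) then g′_L(β₀) < r = g′_R(β₀), i.e. g is not differentiable at β₀ (when β₀ < D). -/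
open MeasureTheory Set

noncomputable section

/-- If `h` is continuous on `[0, β₀]` with `0 < β₀`, the left derivative of `gfun` at `β₀` is the
value of the integrand there. -/
theorem hasDerivWithinAt_gfun_Iic {c y r β₀ : ℝ} {h : ℝ → ℝ} (hβ₀ : 0 < β₀)
    (hcont : ContinuousOn h (Icc 0 β₀)) :
    HasDerivWithinAt (gfun c y r β₀ h) (2 * c * (-y - Real.sqrt (y ^ 2 - h β₀ / c)))
      (Iic β₀) β₀ := by
  set f : ℝ → ℝ := fun u => 2 * c * (-y - Real.sqrt (y ^ 2 - h u / c)) with hf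
  have hfc : ContinuousOn f (Icc 0 β₀) := by
    have := hcont.div_const c
    fun_prop
  set F : ℝ → ℝ := IccExtend hβ₀.le ((Icc 0 β₀).domRestrict f) with hF
  have hFc : Continuous F := hfc.domRestrict.Icc_extend'
  have hFf : ∀ u ∈ Icc 0 β₀, F u = f u := fun u hu => IccExtend_of_mem _ _ hu
  have hint : ∀ x ∈ Icc 0 β₀, gfun c y r β₀ h x = ∫ u in (0 : ℝ)..x, F u := by
    intro x hx
    rw [gfun, if_pos hx.2, intervalIntegral.integral_of_le hx.1]
    exact setIntegral_congr_fun measurableSet_Ioc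
      fun u hu => (hFf u ⟨hu.1.le, hu.2.trans hx.2⟩).symm
  have hmem : β₀ ∈ Icc 0 β₀ := right_mem_Icc.2 hβ₀.le
  have hd : HasDerivWithinAt (fun x => ∫ u in (0 : ℝ)..x, F u) (f β₀) (Iic β₀) β₀ := by
    rw [← hFf β₀ hmem]
    exact (hFc.integral_hasStrictDerivAt 0 β₀).hasDerivAt.hasDerivWithinAt
  refine hd.congr_of_eventuallyEq ?_ (hint β₀ hmem)
  filter_upwards [Icc_mem_nhdsLE hβ₀] with x hx using hint x hx

/-- For `β₀ ≤ 0` the function `gfun` vanishes to the left of `β₀`. -/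
theorem hasDerivWithinAt_gfun_Iic_of_nonpos {c y r β₀ : ℝ} {h : ℝ → ℝ} (hβ₀ : β₀ ≤ 0) :
    HasDerivWithinAt (gfun c y r β₀ h) 0 (Iic β₀) β₀ := by
  have hz : ∀ x ∈ Iic β₀, gfun c y r β₀ h x = 0 := fun x hx => by
    rw [gfun, if_pos (mem_Iic.1 hx), Ioc_eq_empty (not_lt.2 (le_trans hx hβ₀)), setIntegral_empty]
  exact (hasDerivWithinAt_const β₀ (Iic β₀) (0 : ℝ)).congr hz (hz β₀ self_mem_Iic)

/-- The right derivative of `gfun` at `β₀` is the slope `r` of its affine part. -/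
theorem hasDerivWithinAt_gfun_Ici (c y r β₀ : ℝ) (h : ℝ → ℝ) :
    HasDerivWithinAt (gfun c y r β₀ h) r (Ici β₀) β₀ := by
  have hd : HasDerivWithinAt (fun x => gfun c y r β₀ h β₀ + r * (x - β₀)) r (Ici β₀) β₀ := by
    simpa using
      ((((hasDerivAt_id β₀).sub_const β₀).const_mul r).const_add
        (gfun c y r β₀ h β₀)).hasDerivWithinAt
  have he : ∀ x ∈ Ici β₀, gfun c y r β₀ h x = gfun c y r β₀ h β₀ + r * (x - β₀) := by
    intro x hx
    rcases eq_or_lt_of_le (mem_Ici.1 hx) with rfl | hlt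
    · simp
    · rw [gfun, if_neg (not_le.2 hlt), gfun, if_pos le_rfl]
  exact hd.congr he (he β₀ self_mem_Ici)

/-- differentiability of `g` at the free boundary: when
`h(β₀) = −r²/(4c) − ry`, one has `y² − h(β₀)/c = (y + r/(2c))²`, the left-derivative
of `g` at `β₀` equals `2c(−y − |y + r/(2c)|) = min(r, −4cy − r)`; this equals `r` iff
`−y ≥ r/(2c)`, and if `−y < r/(2c)` and `β₀ < D`, then the left-derivative is strictly
less than `r`, the right-derivative is `r`, and `g` is not differentiable at `β₀`. -/
theorem stmt18 (c1 c2 y r D : ℝ) (hc1 : 0 < c1) (hc2 : 0 < c2) (hr : 0 < r) (hD : 0 < D)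
    (h : ℝ → ℝ) (hcont : ContinuousOn h (Icc 0 D)) (hmono : StrictMonoOn h (Icc 0 D))
    (hnn : ∀ u ∈ Icc (0:ℝ) D, 0 ≤ h u) (h0 : h 0 = 0)
    (c : ℝ) (hc : c = (c1⁻¹ + c2⁻¹)⁻¹)
    (hy : r / (4 * c) ≤ -y)
    (hcond : -(h D) ≤ r ^ 2 / (4 * c) + r * y)
    (β₀ : ℝ) (hβmem : β₀ ∈ Icc (0:ℝ) D) (hβ : h β₀ = -(r ^ 2 / (4 * c)) - r * y) :
    y ^ 2 - h β₀ / c = (y + r / (2 * c)) ^ 2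
    ∧ 2 * c * (-y - |y + r / (2 * c)|) = min r (-(4 * c * y) - r)
    ∧ HasDerivWithinAt (gfun c y r β₀ h) (min r (-(4 * c * y) - r)) (Iic β₀) β₀
    ∧ (min r (-(4 * c * y) - r) = r ↔ r / (2 * c) ≤ -y)
    ∧ (-y < r / (2 * c) → β₀ < D →
        min r (-(4 * c * y) - r) < r
        ∧ HasDerivWithinAt (gfun c y r β₀ h) r (Ici β₀) β₀
        ∧ ¬ DifferentiableAt ℝ (gfun c y r β₀ h) β₀) := by
  have hc0 : 0 < c := by rw [hc]; positivity
  have hsq : y ^ 2 - h β₀ / c = (y + r / (2 * c)) ^ 2 := by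
    rw [hβ]; field_simp; ring
  have hcr : 2 * c * (r / (2 * c)) = r := by field_simp
  have hval : 2 * c * (-y - |y + r / (2 * c)|) = min r (-(4 * c * y) - r) := by
    rcases le_total 0 (y + r / (2 * c)) with hs | hs
    · have := mul_nonneg (by positivity : 0 ≤ 2 * c) hs
      rw [abs_of_nonneg hs, min_eq_right (by linarith)]
      linarith
    · have := mul_nonpos_of_nonneg_of_nonpos (by positivity : 0 ≤ 2 * c) hs
      rw [abs_of_nonpos hs, min_eq_left (by linarith)]
      linarith
  have hiff : min r (-(4 * c * y) - r) = r ↔ r / (2 * c) ≤ -y := by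
    rw [min_eq_left_iff, div_le_iff₀ (by positivity)]
    constructor <;> intro <;> linarith
  have hleft : HasDerivWithinAt (gfun c y r β₀ h) (min r (-(4 * c * y) - r)) (Iic β₀) β₀ := by
    rcases hβmem.1.eq_or_lt with hz | hpos
    · have hy0 : -(4 * c * y) - r = 0 := by
        rw [← hz, h0] at hβ
        field_simp at hβ
        exact (mul_eq_zero.1 (by linarith : r * (-(4 * c * y) - r) = 0)).resolve_left hr.ne'
      rw [hy0, min_eq_right hr.le]
      exact hasDerivWithinAt_gfun_Iic_of_nonpos hz.ge
    · have hd := hasDerivWithinAt_gfun_Iic (c := c) (y := y) (r := r) hpos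
        (hcont.mono (Icc_subset_Icc_right hβmem.2))
      rwa [hsq, Real.sqrt_sq_eq_abs, hval] at hd
  refine ⟨hsq, hval, hleft, hiff, fun hlt _ => ?_⟩
  have hmin : min r (-(4 * c * y) - r) < r :=
    lt_of_le_of_ne (min_le_left _ _) fun he => hlt.not_ge (hiff.1 he)
  have hright := hasDerivWithinAt_gfun_Ici c y r β₀ h
  refine ⟨hmin, hright, fun hdiff => hmin.ne ?_⟩
  have hL := (uniqueDiffWithinAt_Iic β₀).eq_deriv _ hleft hdiff.hasDerivAt.hasDerivWithinAt
  have hR := (uniqueDiffWithinAt_Ici β₀).eq_deriv _ hright hdiff.hasDerivAt.hasDerivWithinAt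
  exact hL.trans hR.symm
end
end
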